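/- arXiv:2111.09555 — 10 statements merged into one kernel-verified Lean document; each statement's English description precedes it below -/
import Mathlib

section
/- Let r ≥ 1, let Ω : ℝ^r × ℝ^r → ℝ be a skew-symmetric bilinear form, and for a nonzero vector n ∈ (ℤ≥0)^r and c ∈ ℝ let S_n^c : (0,∞)^r → (0,∞)^r be defined by (S_n^c(y))_i = y_i (1 + y^n)^{c Ω(n, e_i)}, where y^n = ∏_j y_j^{n_j}. If n₁, n₂ ∈ (ℤ≥0)^r are nonzero and Ω(n₂, n₁) = 0, then for all c₁, c₂ ∈ ℝ the maps commute: S_{n₁}^{c₁} ∘ S_{n₂}^{c₂} = S_{n₂}^{c₂} ∘ S_{n₁}^{c₁} as maps (0,∞)^r → (0,∞)^r. -/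
/-- The positive orthant `(0,∞)^r`. -/
def PosOrthant (r : ℕ) := {y : Fin r → ℝ // ∀ i, 0 < y i}

/-- The point map `S_n^c` on the positive orthant:
`(S_n^c(y))_i = y_i (1 + y^n)^{c Ω(n, e_i)}` where `y^n = ∏_j y_j^{n_j}`. -/
noncomputable def Smap {r : ℕ} (Ω : (Fin r → ℝ) →ₗ[ℝ] (Fin r → ℝ) →ₗ[ℝ] ℝ)
    (n : Fin r → ℕ) (c : ℝ) (y : PosOrthant r) : PosOrthant r :=
  ⟨fun i => y.1 i * (1 + ∏ j, y.1 j ^ (n j)) ^ (c * Ω (fun j => (n j : ℝ)) (Pi.single i 1)),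
   fun i => mul_pos (y.2 i) (Real.rpow_pos_of_pos
      (by
        have h : 0 < ∏ j, y.1 j ^ (n j) :=
          Finset.prod_pos fun j _ => pow_pos (y.2 j) _
        linarith) _)⟩

theorem Smap_prod_aux {r : ℕ} (Ω : (Fin r → ℝ) →ₗ[ℝ] (Fin r → ℝ) →ₗ[ℝ] ℝ)
    (n m : Fin r → ℕ) (c : ℝ) (y : PosOrthant r)
    (h : Ω (fun j => (n j : ℝ)) (fun j => (m j : ℝ)) = 0) :
    ∏ j, (Smap Ω n c y).1 j ^ (m j) = ∏ j, y.1 j ^ (m j) := by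
  have hp : 0 < ∏ j, y.1 j ^ (n j) := Finset.prod_pos fun j _ => pow_pos (y.2 j) _
  have hp1 : 0 < 1 + ∏ j, y.1 j ^ (n j) := by linarith
  have hs : ∑ j, c * Ω (fun j => (n j : ℝ)) (Pi.single j 1) * (m j : ℝ) = 0 := by
    have h2 := LinearMap.pi_apply_eq_sum_univ (Ω (fun j => (n j : ℝ))) (fun j => (m j : ℝ))
    rw [h] at h2
    have h3 : ∑ j, c * Ω (fun j => (n j : ℝ)) (Pi.single j 1) * (m j : ℝ)
        = c * ∑ j, (m j : ℝ) • Ω (fun j => (n j : ℝ)) (Pi.single j 1) := by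
      rw [Finset.mul_sum]
      refine Finset.sum_congr rfl fun j _ => ?_
      rw [smul_eq_mul]; ring
    rw [h3]
    have h4 : ∀ j : Fin r, (Pi.single j 1 : Fin r → ℝ) = fun k => if j = k then 1 else 0 := by
      intro j; ext k; simp [Pi.single_apply, eq_comm]
    simp only [h4]
    rw [← h2, mul_zero]
  simp only [Smap, mul_pow, Finset.prod_mul_distrib]
  simp only [← Real.rpow_mul_natCast hp1.le]
  rw [← Real.rpow_sum_of_pos hp1, hs, Real.rpow_zero, mul_one]

/-- Commutation relation for dilogarithm elements in the `y`-representation: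
if `Ω(n₂, n₁) = 0` then `S_{n₁}^{c₁}` and `S_{n₂}^{c₂}` commute. -/
theorem commutation_relation (r : ℕ) (hr : 1 ≤ r)
    (Ω : (Fin r → ℝ) →ₗ[ℝ] (Fin r → ℝ) →ₗ[ℝ] ℝ)
    (hskew : ∀ v w, Ω v w = - Ω w v)
    (n₁ n₂ : Fin r → ℕ) (hn₁ : n₁ ≠ 0) (hn₂ : n₂ ≠ 0)
    (hΩ : Ω (fun j => (n₂ j : ℝ)) (fun j => (n₁ j : ℝ)) = 0)
    (c₁ c₂ : ℝ) :
    Smap Ω n₁ c₁ ∘ Smap Ω n₂ c₂ = Smap Ω n₂ c₂ ∘ Smap Ω n₁ c₁ := by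
  have h' : Ω (fun j => (n₁ j : ℝ)) (fun j => (n₂ j : ℝ)) = 0 := by
    rw [hskew, hΩ, neg_zero]
  funext y
  apply Subtype.ext
  funext i
  have e1 := Smap_prod_aux Ω n₂ n₁ c₂ y hΩ
  have e2 := Smap_prod_aux Ω n₁ n₂ c₁ y h'
  change (Smap Ω n₂ c₂ y).1 i * (1 + ∏ j, (Smap Ω n₂ c₂ y).1 j ^ (n₁ j)) ^ _
    = (Smap Ω n₁ c₁ y).1 i * (1 + ∏ j, (Smap Ω n₁ c₁ y).1 j ^ (n₂ j)) ^ _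
  rw [e1, e2]
  simp only [Smap]
  ring
end

section
/- Let r ≥ 1, let Ω : ℝ^r × ℝ^r → ℝ be a skew-symmetric bilinear form, and for a nonzero vector n ∈ (ℤ≥0)^r and c ∈ ℝ let S_n^c : (0,∞)^r → (0,∞)^r be defined by (S_n^c(y))_i = y_i (1 + y^n)^{c Ω(n, e_i)}, where y^n = ∏_j y_j^{n_j}. If n₁, n₂ ∈ (ℤ≥0)^r are nonzero and Ω(n₂, n₁) = c with c ≠ 0, then the pentagon relation holds as an identity of maps (0,∞)^r → (0,∞)^r: S_{n₁}^{1/c} ∘ S_{n₂}^{1/c} = S_{n₂}^{1/c} ∘ S_{n₁+n₂}^{1/c} ∘ S_{n₁}^{1/c}. -/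
noncomputable def mono {r : ℕ} (m : Fin r → ℕ) (y : PosOrthant r) : ℝ := ∏ j, y.1 j ^ (m j)

theorem mono_pos {r : ℕ} (m : Fin r → ℕ) (y : PosOrthant r) : 0 < mono m y :=
  Finset.prod_pos fun j _ => pow_pos (y.2 j) _

theorem mono_Smap {r : ℕ} (Ω : (Fin r → ℝ) →ₗ[ℝ] (Fin r → ℝ) →ₗ[ℝ] ℝ)
    (n m : Fin r → ℕ) (d : ℝ) (y : PosOrthant r) :
    mono m (Smap Ω n d y) = mono m y *
      (1 + mono n y) ^ (d * Ω (fun j => (n j : ℝ)) (fun j => (m j : ℝ))) := by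
  have hp : 0 < 1 + mono n y := by linarith [mono_pos n y]
  have hm : (fun j => (m j : ℝ)) = ∑ j, (m j : ℝ) • (Pi.single j (1 : ℝ) : Fin r → ℝ) := by
    ext k
    simp [Finset.sum_apply, Pi.single_apply]
  rw [hm, map_sum, Finset.mul_sum, Real.rpow_sum_of_pos hp, mono, mono, ← Finset.prod_mul_distrib]
  refine Finset.prod_congr rfl fun j _ => ?_
  rw [Smap]
  simp only [mul_pow, map_smul, smul_eq_mul]
  congr 1
  change ((1 + mono n y) ^ _) ^ _ = _
  rw [← Real.rpow_mul_natCast hp.le]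
  congr 1
  ring

theorem Smap_apply {r : ℕ} (Ω : (Fin r → ℝ) →ₗ[ℝ] (Fin r → ℝ) →ₗ[ℝ] ℝ)
    (n : Fin r → ℕ) (d : ℝ) (y : PosOrthant r) (i : Fin r) :
    (Smap Ω n d y).1 i = y.1 i *
      (1 + mono n y) ^ (d * Ω (fun j => (n j : ℝ)) (Pi.single i 1)) := rfl

/-- Pentagon relation for dilogarithm elements in the `y`-representation:
if `Ω(n₂, n₁) = c ≠ 0` then
`S_{n₁}^{1/c} ∘ S_{n₂}^{1/c} = S_{n₂}^{1/c} ∘ S_{n₁+n₂}^{1/c} ∘ S_{n₁}^{1/c}`. -/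
theorem pentagon_relation (r : ℕ) (hr : 1 ≤ r)
    (Ω : (Fin r → ℝ) →ₗ[ℝ] (Fin r → ℝ) →ₗ[ℝ] ℝ)
    (hskew : ∀ v w, Ω v w = - Ω w v)
    (n₁ n₂ : Fin r → ℕ) (hn₁ : n₁ ≠ 0) (hn₂ : n₂ ≠ 0)
    (c : ℝ) (hc : c ≠ 0)
    (hΩ : Ω (fun j => (n₂ j : ℝ)) (fun j => (n₁ j : ℝ)) = c) :
    Smap Ω n₁ (1/c) ∘ Smap Ω n₂ (1/c)
      = Smap Ω n₂ (1/c) ∘ Smap Ω (n₁ + n₂) (1/c) ∘ Smap Ω n₁ (1/c) := by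
  have hadd : (fun j => ((n₁ + n₂) j : ℝ)) = (fun j => (n₁ j : ℝ)) + (fun j => (n₂ j : ℝ)) := by
    ext k; simp
  have h11 : Ω (fun j => (n₁ j : ℝ)) (fun j => (n₁ j : ℝ)) = 0 := by
    linarith [hskew (fun j => (n₁ j : ℝ)) (fun j => (n₁ j : ℝ))]
  have h22 : Ω (fun j => (n₂ j : ℝ)) (fun j => (n₂ j : ℝ)) = 0 := by
    linarith [hskew (fun j => (n₂ j : ℝ)) (fun j => (n₂ j : ℝ))]
  have h12 : Ω (fun j => (n₁ j : ℝ)) (fun j => (n₂ j : ℝ)) = -c := by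
    rw [hskew, hΩ]
  funext y
  apply Subtype.ext
  funext i
  have hab : ∀ y : PosOrthant r, mono (n₁ + n₂) y = mono n₁ y * mono n₂ y := by
    intro y
    simp [mono, pow_add, Finset.prod_mul_distrib]
  have ha := mono_pos n₁ y
  have hb := mono_pos n₂ y
  have e1 : 1 / c * c = 1 := by field_simp
  have e2 : 1 / c * -c = -1 := by field_simp
  simp only [Function.comp_apply, Smap_apply, mono_Smap, hab, hadd, map_add,
    LinearMap.add_apply, h11, h22, h12, hΩ, add_zero, zero_add, mul_zero, Real.rpow_zero, mul_one,
    e1, e2, Real.rpow_one, Real.rpow_neg_one]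
  generalize mono n₁ y = a at ha ⊢
  generalize mono n₂ y = b at hb ⊢
  rw [mul_add (1 / c)]
  generalize 1 / c * Ω (fun j => (n₁ j : ℝ)) (Pi.single i 1) = α
  generalize 1 / c * Ω (fun j => (n₂ j : ℝ)) (Pi.single i 1) = β
  have hP : 0 < 1 + a + a * b := by positivity
  have f1 : 1 + a * (1 + b) = 1 + a + a * b := by ring
  have f2 : 1 + a * (b * (1 + a)⁻¹) = (1 + a + a * b) / (1 + a) := by field_simp
  have f3 : 1 + b * (1 + a)⁻¹ * ((1 + a + a * b) / (1 + a))⁻¹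
      = (1 + a) * (1 + b) / (1 + a + a * b) := by field_simp; ring
  rw [f1, f2, f3, Real.rpow_add (by positivity), Real.div_rpow (by positivity) (by positivity),
    Real.div_rpow (by positivity) (by positivity), Real.div_rpow (by positivity) (by positivity),
    Real.mul_rpow (by positivity) (by positivity)]
  have g1 : 0 < (1 + a) ^ α := by positivity
  have g2 : 0 < (1 + a) ^ β := by positivity
  have g3 : 0 < (1 + a + a * b) ^ β := by positivity
  field_simp
end

section
/- For all real x, y with 0 < x < 1 and 0 < y < 1, the pentagon (five-term) identity holds: L(x) + L(y) = L(xy) + L(x(1−y)/(1−xy)) + L(y(1−x)/(1−xy)), where all five arguments lie in (0,1). -/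
/-- The Euler dilogarithm `Li₂(x) = ∑_{j=1}^∞ x^j / j²` (for `|x| < 1`). -/
noncomputable def Li2 (x : ℝ) : ℝ := ∑' j : ℕ, x ^ (j + 1) / ((j : ℝ) + 1) ^ 2

/-- The Rogers dilogarithm `L(x) = Li₂(x) + (1/2) log x · log(1−x)` (for `0 < x < 1`). -/
noncomputable def RogersL (x : ℝ) : ℝ := Li2 x + (1 / 2) * Real.log x * Real.log (1 - x)

open Filter Topology in
lemma Li2_hasDerivAt {x : ℝ} (hx : |x| < 1) :
    HasDerivAt Li2 (∑' j : ℕ, x ^ j / ((j : ℝ) + 1)) x := by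
  obtain ⟨r, hr1, hr2⟩ := exists_between hx
  have hr0 : 0 ≤ r := (abs_nonneg x).trans hr1.le
  have key := hasDerivAt_tsum_of_isPreconnected (𝕜 := ℝ) (F := ℝ)
    (g := fun (j : ℕ) (z : ℝ) => z ^ (j + 1) / ((j : ℝ) + 1) ^ 2)
    (g' := fun (j : ℕ) (z : ℝ) => z ^ j / ((j : ℝ) + 1)) (u := fun j => r ^ j)
    (t := Set.Ioo (-r) r) (y₀ := 0) (y := x)
    (summable_geometric_of_lt_one hr0 hr2) isOpen_Ioo isPreconnected_Ioo ?_ ?_ ?_ ?_ ?_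
  · exact key
  · intro n z _
    have h := (hasDerivAt_pow (n + 1) z).div_const (((n : ℝ) + 1) ^ 2)
    refine HasDerivAt.congr_deriv h ?_
    have : (n : ℝ) + 1 ≠ 0 := by positivity
    push_cast
    field_simp
  · intro n z hz
    have hz' : |z| ≤ r := (abs_lt.2 hz).le
    rw [Real.norm_eq_abs, abs_div, abs_pow]
    have h1 : (1 : ℝ) ≤ |(n : ℝ) + 1| := by
      rw [abs_of_nonneg (by positivity)]
      have : (0 : ℝ) ≤ n := by positivity
      linarith
    calc |z| ^ n / |(n : ℝ) + 1| ≤ |z| ^ n := div_le_self (by positivity) h1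
      _ ≤ r ^ n := by gcongr
  · have : 0 < r := lt_of_le_of_lt (abs_nonneg x) hr1
    constructor <;> linarith
  · simp [summable_zero]
  · exact abs_lt.1 hr1

lemma Li2_hasDerivAt' {x : ℝ} (h0 : 0 < x) (h1 : x < 1) :
    HasDerivAt Li2 (-Real.log (1 - x) / x) x := by
  have hx : |x| < 1 := by rwa [abs_of_pos h0]
  convert Li2_hasDerivAt hx using 1
  rw [← (Real.hasSum_pow_div_log_of_abs_lt_one hx).tsum_eq, ← tsum_div_const]
  congr 1
  ext j
  have : (j : ℝ) + 1 ≠ 0 := by positivity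
  have := h0.ne'
  field_simp
  ring

lemma RogersL_hasDerivAt {x : ℝ} (h0 : 0 < x) (h1 : x < 1) :
    HasDerivAt RogersL (-(1 / 2) * (Real.log (1 - x) / x + Real.log x / (1 - x))) x := by
  have hb : 1 - x ≠ 0 := by linarith
  have ha : x ≠ 0 := h0.ne'
  have h := (Li2_hasDerivAt' h0 h1).add
    (((Real.hasDerivAt_log ha).const_mul (1 / 2)).mul
      (((hasDerivAt_id x).const_sub 1).log hb))
  refine HasDerivAt.congr_deriv h ?_
  simp only [id]
  field_simp
  ring

lemma RogersL_zero : RogersL 0 = 0 := by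
  simp [RogersL, Li2]

open Filter Topology in
lemma RogersL_continuousAt_zero : ContinuousAt RogersL 0 := by
  have h1 : ContinuousAt Li2 0 := (Li2_hasDerivAt (by simp)).continuousAt
  have h2 : Tendsto (fun x : ℝ => Real.log x * Real.log (1 - x)) (𝓝 0) (𝓝 0) := by
    have hd : HasDerivAt (fun x : ℝ => Real.log (1 - x)) (-1 / (1 - 0)) 0 :=
      ((hasDerivAt_id (0 : ℝ)).const_sub 1).log (by norm_num)
    have hO := hd.isBigO_sub
    simp only [sub_zero, Real.log_one] at hO
    have hO2 := (Asymptotics.isBigO_refl Real.log (𝓝 0)).mul hO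
    refine hO2.trans_tendsto ?_
    have := Real.continuous_mul_log.tendsto 0
    simpa [mul_comm] using this
  have h3 : ContinuousAt (fun x : ℝ => (1 / 2) * (Real.log x * Real.log (1 - x))) 0 := by
    have := h2.const_mul (1 / 2 : ℝ)
    simpa [ContinuousAt] using this
  have h4 := h1.add h3
  refine h4.congr (Eventually.of_forall fun x => ?_)
  simp [RogersL, mul_assoc]

lemma pent_mem {x y : ℝ} (hx0 : 0 < x) (hx1 : x < 1) (hy0 : 0 < y) (hy1 : y < 1) :
    (x * y ∈ Set.Ioo (0 : ℝ) 1 ∧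
      x * (1 - y) / (1 - x * y) ∈ Set.Ioo (0 : ℝ) 1 ∧
      y * (1 - x) / (1 - x * y) ∈ Set.Ioo (0 : ℝ) 1) := by
  have h : x * y < 1 := by nlinarith
  have h' : 0 < 1 - x * y := by linarith
  have hx : 0 < 1 - x := by linarith
  have hy : 0 < 1 - y := by linarith
  refine ⟨⟨by positivity, h⟩, ⟨by positivity, ?_⟩, ⟨by positivity, ?_⟩⟩ <;>
  · rw [div_lt_one h']; nlinarith

lemma pent_deriv {x y : ℝ} (hx0 : 0 < x) (hx1 : x < 1) (hy0 : 0 < y) (hy1 : y < 1) :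
    HasDerivAt (fun x => RogersL x + RogersL y
      - (RogersL (x * y) + RogersL (x * (1 - y) / (1 - x * y))
        + RogersL (y * (1 - x) / (1 - x * y)))) 0 x := by
  obtain ⟨⟨p1, p2⟩, ⟨q1, q2⟩, ⟨r1, r2⟩⟩ := pent_mem hx0 hx1 hy0 hy1
  have h' : 0 < 1 - x * y := by linarith
  have hx : 0 < 1 - x := by linarith
  have hy : 0 < 1 - y := by linarith
  have n1 := hx0.ne'
  have n2 := hy0.ne'
  have n3 := hx.ne'
  have n4 := hy.ne'
  have n5 := h'.ne'
  have dm : HasDerivAt (fun x => x * y) y x := by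
    simpa using (hasDerivAt_id x).mul_const y
  have dd : HasDerivAt (fun x => 1 - x * y) (-y) x := dm.const_sub 1
  have du : HasDerivAt (fun x => x * (1 - y) / (1 - x * y)) ((1 - y) / (1 - x * y) ^ 2) x := by
    have := ((hasDerivAt_id x).mul_const (1 - y)).div dd n5
    refine HasDerivAt.congr_deriv this ?_
    simp only [id]
    ring
  have dv : HasDerivAt (fun x => y * (1 - x) / (1 - x * y))
      (-(y * (1 - y)) / (1 - x * y) ^ 2) x := by
    have := (((hasDerivAt_id x).const_sub 1).const_mul y).div dd n5
    refine HasDerivAt.congr_deriv this ?_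
    simp only [id]
    ring
  have D := ((RogersL_hasDerivAt hx0 hx1).add_const (RogersL y)).sub
    ((((RogersL_hasDerivAt p1 p2).comp x dm).add ((RogersL_hasDerivAt q1 q2).comp x du)).add
      ((RogersL_hasDerivAt r1 r2).comp x dv))
  refine HasDerivAt.congr_deriv D ?_
  have e1 : 1 - x * (1 - y) / (1 - x * y) = (1 - x) / (1 - x * y) := by field_simp; ring
  have e2 : 1 - y * (1 - x) / (1 - x * y) = (1 - y) / (1 - x * y) := by
    rw [eq_div_iff n5, sub_mul, div_mul_cancel₀ _ n5]; ring
  rw [e1, e2, Real.log_div n3 n5, Real.log_div n4 n5, Real.log_div (by positivity) n5,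
    Real.log_div (by positivity) n5, Real.log_mul n1 n2, Real.log_mul n1 n4, Real.log_mul n2 n3]
  generalize Real.log x = a
  generalize Real.log (1 - x) = b
  generalize Real.log y = c
  generalize Real.log (1 - y) = d
  generalize Real.log (1 - x * y) = e
  field_simp
  ring

lemma pent_cont {y : ℝ} (hy0 : 0 < y) (hy1 : y < 1) :
    ContinuousAt (fun x => RogersL x + RogersL y
      - (RogersL (x * y) + RogersL (x * (1 - y) / (1 - x * y))
        + RogersL (y * (1 - x) / (1 - x * y)))) 0 := by
  have cu : ContinuousAt (fun x : ℝ => x * (1 - y) / (1 - x * y)) 0 :=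
    ContinuousAt.div (by fun_prop) (by fun_prop) (by simp)
  have cv : ContinuousAt (fun x : ℝ => y * (1 - x) / (1 - x * y)) 0 :=
    ContinuousAt.div (by fun_prop) (by fun_prop) (by simp)
  have cm : ContinuousAt (fun x : ℝ => x * y) 0 := by fun_prop
  have c0 := RogersL_continuousAt_zero
  have c1 := (RogersL_hasDerivAt hy0 hy1).continuousAt
  refine (c0.add continuousAt_const).sub (((c0.comp_of_eq cm (by simp)).add
    (c0.comp_of_eq cu (by simp))).add (c1.comp_of_eq cv (by simp)))

/-- The pentagon (five-term) identity for the Rogers dilogarithm. -/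
theorem rogers_pentagon (x y : ℝ) (hx0 : 0 < x) (hx1 : x < 1) (hy0 : 0 < y) (hy1 : y < 1) :
    (x * y ∈ Set.Ioo (0 : ℝ) 1 ∧
      x * (1 - y) / (1 - x * y) ∈ Set.Ioo (0 : ℝ) 1 ∧
      y * (1 - x) / (1 - x * y) ∈ Set.Ioo (0 : ℝ) 1) ∧
    RogersL x + RogersL y
      = RogersL (x * y) + RogersL (x * (1 - y) / (1 - x * y))
        + RogersL (y * (1 - x) / (1 - x * y)) := by
  refine ⟨pent_mem hx0 hx1 hy0 hy1, ?_⟩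
  obtain ⟨c, hc, h⟩ := exists_hasDerivAt_eq_slope (fun x => RogersL x + RogersL y
      - (RogersL (x * y) + RogersL (x * (1 - y) / (1 - x * y))
        + RogersL (y * (1 - x) / (1 - x * y)))) (fun _ => 0) hx0 (by
      intro z hz
      rcases hz.1.eq_or_lt with h | h
      · subst h
        exact (pent_cont hy0 hy1).continuousWithinAt
      · exact (pent_deriv h (hz.2.trans_lt hx1) hy0 hy1).continuousAt.continuousWithinAt)
    (fun z hz => pent_deriv hz.1 (hz.2.trans hx1) hy0 hy1)
  have h2 := (div_eq_zero_iff.1 h.symm).resolve_right (by linarith)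
  simp only [zero_mul, zero_div, sub_zero, mul_one, div_one, RogersL_zero] at h2
  linarith
end

section
/- For all real y₁ > 0 and y₂ > 0, the pentagon identity in modified Rogers dilogarithm form holds: L̃(y₂(1+y₁)) + L̃(y₁) = L̃(y₁/(1+y₂+y₁y₂)) + L̃(y₁y₂/(1+y₂)) + L̃(y₂). -/
/-- The modified Rogers dilogarithm
`L̃(x) = ∫₀ˣ log(1+t)/t dt − (1/2) log x · log(1+x)` (for `x > 0`). -/
noncomputable def Ltilde (x : ℝ) : ℝ :=
  (∫ t in (0 : ℝ)..x, Real.log (1 + t) / t) - (1 / 2) * Real.log x * Real.log (1 + x)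

noncomputable def hh : ℝ → ℝ := dslope (fun t : ℝ => Real.log (1 + t)) 0

theorem hh_of_ne {t : ℝ} (ht : t ≠ 0) : hh t = Real.log (1 + t) / t := by
  unfold hh
  rw [dslope_of_ne _ ht, slope_def_field]
  simp

theorem log1_hasDerivAt {t : ℝ} (ht : -1 < t) :
    HasDerivAt (fun t : ℝ => Real.log (1 + t)) (1 / (1 + t)) t := by
  have h : HasDerivAt (fun t : ℝ => 1 + t) 1 t := (hasDerivAt_id t).const_add 1
  exact h.log (by linarith)

theorem hh_cont {t : ℝ} (ht : -1 < t) : ContinuousAt hh t := by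
  unfold hh
  by_cases h0 : t = 0
  · subst h0
    exact continuousAt_dslope_same.2 (log1_hasDerivAt ht).differentiableAt
  · exact (continuousAt_dslope_of_ne h0).2 (log1_hasDerivAt ht).continuousAt

theorem Ltilde_eq (x : ℝ) :
    Ltilde x = (∫ t in (0 : ℝ)..x, hh t) - (1 / 2) * ((x * Real.log x) * hh x) := by
  unfold Ltilde
  congr 1
  · apply intervalIntegral.integral_congr_ae
    have : ∀ᵐ t : ℝ, t ≠ 0 := by
      simp [MeasureTheory.ae_iff]
    filter_upwards [this] with t ht _
    rw [hh_of_ne ht]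
  · by_cases hx : x = 0
    · simp [hx]
    · rw [hh_of_ne hx]; field_simp

theorem J_deriv {x : ℝ} (hx : 0 ≤ x) :
    HasDerivAt (fun x => ∫ t in (0 : ℝ)..x, hh t) (hh x) x := by
  have hc : ContinuousOn hh (Set.Ioi (-1)) := fun t ht => (hh_cont ht).continuousWithinAt
  apply intervalIntegral.integral_hasDerivAt_right
  · apply ContinuousOn.intervalIntegrable
    apply hc.mono
    rw [Set.uIcc_of_le hx]
    intro t ht
    have := ht.1
    simp only [Set.mem_Ioi]; linarith
  · exact hc.stronglyMeasurableAtFilter isOpen_Ioi x (by simp only [Set.mem_Ioi]; linarith)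
  · exact hh_cont (by linarith)

theorem Ltilde_cont {x : ℝ} (hx : 0 ≤ x) : ContinuousAt Ltilde x := by
  have e : Ltilde = fun x => (∫ t in (0 : ℝ)..x, hh t) - (1 / 2) * ((x * Real.log x) * hh x) :=
    funext Ltilde_eq
  rw [e]
  exact (J_deriv hx).continuousAt.sub (continuousAt_const.mul
    (Real.continuous_mul_log.continuousAt.mul (hh_cont (by linarith))))

theorem Ltilde_deriv {x : ℝ} (hx : 0 < x) :
    HasDerivAt Ltilde (1 / 2 * (Real.log (1 + x) / x - Real.log x / (1 + x))) x := by
  have h1 := (J_deriv hx.le).sub ((((Real.hasDerivAt_log hx.ne').mul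
    (log1_hasDerivAt (t := x) (by linarith)))).const_mul (1 / 2))
  rw [hh_of_ne hx.ne'] at h1
  refine (h1.congr_of_eventuallyEq ?_).congr_deriv ?_
  · filter_upwards [eventually_ne_nhds hx.ne'] with y hy
    rw [Ltilde_eq, hh_of_ne hy]
    simp only [Pi.sub_apply, Pi.mul_apply]
    field_simp
  · field_simp; ring

theorem Ltilde_comp {u : ℝ → ℝ} {u' a : ℝ} (hu : HasDerivAt u u' a) (hp : 0 < u a) :
    HasDerivAt (fun a => Ltilde (u a))
      (1 / 2 * (Real.log (1 + u a) / u a - Real.log (u a) / (1 + u a)) * u') a :=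
  (Ltilde_deriv hp).comp a hu

/-- The pentagon identity in modified Rogers dilogarithm form. -/
theorem pentagon_Ltilde (y₁ y₂ : ℝ) (hy₁ : 0 < y₁) (hy₂ : 0 < y₂) :
    Ltilde (y₂ * (1 + y₁)) + Ltilde y₁
      = Ltilde (y₁ / (1 + y₂ + y₁ * y₂)) + Ltilde (y₁ * y₂ / (1 + y₂)) + Ltilde y₂ := by
  have hE : ∀ a : ℝ, 0 ≤ a → 0 < 1 + y₂ + a * y₂ := fun a ha => by positivity
  have hcont : ContinuousOn (fun a => Ltilde (y₂ * (1 + a)) + Ltilde a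
      - Ltilde (a / (1 + y₂ + a * y₂)) - Ltilde (a * y₂ / (1 + y₂))) (Set.Icc 0 y₁) := by
    intro a ha
    have ha0 := ha.1
    have hEa := hE a ha0
    apply ContinuousAt.continuousWithinAt
    refine ((ContinuousAt.add ?_ (Ltilde_cont ha0)).sub ?_).sub ?_
    · exact ContinuousAt.comp' (f := fun a => y₂ * (1 + a)) (Ltilde_cont (by positivity)) (by fun_prop)
    · exact ContinuousAt.comp' (f := fun a => a / (1 + y₂ + a * y₂)) (Ltilde_cont (by positivity))
        (by fun_prop (disch := exact hEa.ne'))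
    · exact ContinuousAt.comp' (f := fun a => a * y₂ / (1 + y₂)) (Ltilde_cont (by positivity)) (by fun_prop)
  have hder : ∀ a ∈ Set.Ioo 0 y₁, HasDerivAt (fun a => Ltilde (y₂ * (1 + a)) + Ltilde a
      - Ltilde (a / (1 + y₂ + a * y₂)) - Ltilde (a * y₂ / (1 + y₂))) 0 a := by
    intro a ha
    have ha0 : 0 < a := ha.1
    have hEa := hE a ha0.le
    have d1 : HasDerivAt (fun a => y₂ * (1 + a)) y₂ a := by
      simpa using ((hasDerivAt_id a).const_add 1).const_mul y₂
    have d3 : HasDerivAt (fun a => a / (1 + y₂ + a * y₂))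
        ((1 + y₂) / (1 + y₂ + a * y₂) ^ 2) a := by
      have := (hasDerivAt_id a).div
        (((hasDerivAt_id a).mul_const y₂).const_add (1 + y₂)) hEa.ne'
      refine this.congr_deriv ?_
      simp only [id]; congr 1; ring
    have d4 : HasDerivAt (fun a => a * y₂ / (1 + y₂)) (y₂ / (1 + y₂)) a := by
      simpa using ((hasDerivAt_id a).mul_const y₂).div_const (1 + y₂)
    refine ((((Ltilde_comp d1 (by positivity)).add (Ltilde_deriv ha0)).sub
      (Ltilde_comp d3 (by positivity))).sub (Ltilde_comp d4 (by positivity))).congr_deriv ?_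
    have e1 : 1 + y₂ * (1 + a) = 1 + y₂ + a * y₂ := by ring
    have e3 : 1 + a / (1 + y₂ + a * y₂) = (1 + a) * (1 + y₂) / (1 + y₂ + a * y₂) := by
      field_simp; ring
    have e4 : 1 + a * y₂ / (1 + y₂) = (1 + y₂ + a * y₂) / (1 + y₂) := by
      field_simp
    have p1 : 1 + a ≠ 0 := by positivity
    have p2 : 1 + y₂ ≠ 0 := by positivity
    rw [e1, e3, e4, Real.log_mul hy₂.ne' p1, Real.log_div (by positivity) hEa.ne',
      Real.log_mul p1 p2, Real.log_div ha0.ne' hEa.ne', Real.log_div hEa.ne' p2,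
      Real.log_div (by positivity) p2, Real.log_mul ha0.ne' hy₂.ne']
    generalize Real.log (1 + y₂ + a * y₂) = E
    generalize Real.log (1 + a) = C
    generalize Real.log (1 + y₂) = D
    generalize Real.log a = A
    generalize Real.log y₂ = B
    have := hEa.ne'
    generalize hz : 1 + y₂ + a * y₂ = z at *
    field_simp
    subst hz
    ring
  obtain ⟨c, hc, h⟩ := exists_hasDerivAt_eq_slope _ (fun _ => 0) hy₁ hcont hder
  have h0 : Ltilde 0 = 0 := by simp [Ltilde]
  rw [eq_comm, div_eq_zero_iff] at h
  rcases h with h | h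
  · simp [h0] at h
    linarith
  · linarith
end

section
/- Let r ≥ 1, let δ₁, …, δ_r be positive real numbers, and let (b_{ij}) be a real r×r matrix such that δᵢ⁻¹ b_{ij} = −δⱼ⁻¹ b_{ji} for all i, j. Let n ∈ (ℤ≥0)^r be nonzero. For u ∈ ℝ^r define wᵢ(u) = ∑_j b_{ji} u_j, pᵢ(u) = δᵢ wᵢ(u), yᵢ(u) = exp(√2 · wᵢ(u)), and Y(u) = ∏_i yᵢ(u)^{nᵢ}, as well as u'ᵢ(u) = uᵢ − (1/√2) nᵢ δᵢ⁻¹ log(1 + Y(u)) and p'ᵢ(u) = pᵢ(u) + (1/√2) (∑_j n_j b_{ij}) log(1 + Y(u)). Then for every u ∈ ℝ^r and every index k, the partial derivative identity ∂/∂u_k [ L̃(Y(u)) ] = ∑_{i=1}^r p'ᵢ(u) · ∂u'ᵢ/∂u_k(u) − p_k(u) holds. -/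
/-- `wᵢ(u) = ∑_j b_{ji} u_j`. -/
noncomputable def wfun {r : ℕ} (b : Fin r → Fin r → ℝ) (u : Fin r → ℝ) (i : Fin r) : ℝ :=
  ∑ j, b j i * u j

/-- `pᵢ(u) = δᵢ wᵢ(u)`. -/
noncomputable def pfun {r : ℕ} (δ : Fin r → ℝ) (b : Fin r → Fin r → ℝ)
    (u : Fin r → ℝ) (i : Fin r) : ℝ :=
  δ i * wfun b u i

/-- `Y(u) = ∏_i yᵢ(u)^{nᵢ}` where `yᵢ(u) = exp(√2 wᵢ(u))`. -/
noncomputable def Yfun {r : ℕ} (b : Fin r → Fin r → ℝ) (n : Fin r → ℕ)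
    (u : Fin r → ℝ) : ℝ :=
  ∏ i, Real.exp (Real.sqrt 2 * wfun b u i) ^ (n i)

/-- `u'ᵢ(u) = uᵢ − (1/√2) nᵢ δᵢ⁻¹ log(1 + Y(u))`. -/
noncomputable def u'fun {r : ℕ} (δ : Fin r → ℝ) (b : Fin r → Fin r → ℝ) (n : Fin r → ℕ)
    (u : Fin r → ℝ) (i : Fin r) : ℝ :=
  u i - (1 / Real.sqrt 2) * (n i : ℝ) * (δ i)⁻¹ * Real.log (1 + Yfun b n u)

/-- `p'ᵢ(u) = pᵢ(u) + (1/√2) (∑_j n_j b_{ij}) log(1 + Y(u))`. -/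
noncomputable def p'fun {r : ℕ} (δ : Fin r → ℝ) (b : Fin r → Fin r → ℝ) (n : Fin r → ℕ)
    (u : Fin r → ℝ) (i : Fin r) : ℝ :=
  pfun δ b u i + (1 / Real.sqrt 2) * (∑ j, (n j : ℝ) * b i j) * Real.log (1 + Yfun b n u)

theorem Ltilde_hasDerivAt (x : ℝ) (hx : 0 < x) :
    HasDerivAt Ltilde (1 / 2 * (Real.log (1 + x) / x - Real.log x / (1 + x))) x := by
  have hmeas : Measurable (fun t : ℝ => Real.log (1 + t) / t) := by fun_prop
  have hint : IntervalIntegrable (fun t : ℝ => Real.log (1 + t) / t) MeasureTheory.volume 0 x := by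
    rw [intervalIntegrable_iff_integrableOn_Ioc_of_le hx.le]
    refine MeasureTheory.Measure.integrableOn_of_bounded (M := 1) (by simp)
      hmeas.aestronglyMeasurable ?_
    refine (MeasureTheory.ae_restrict_iff' measurableSet_Ioc).2 (Filter.Eventually.of_forall ?_)
    intro t ht
    have ht0 : 0 < t := ht.1
    have h1 : 0 ≤ Real.log (1 + t) := Real.log_nonneg (by linarith)
    have h2 : Real.log (1 + t) ≤ t := by
      have := Real.log_le_sub_one_of_pos (show 0 < 1 + t by linarith)
      linarith
    rw [Real.norm_eq_abs, abs_of_nonneg (by positivity)]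
    exact (div_le_one ht0).2 h2
  have hc : ContinuousAt (fun t : ℝ => Real.log (1 + t) / t) x := by
    refine ContinuousAt.div (ContinuousAt.log (by fun_prop) (by positivity)) continuousAt_id hx.ne'
  have h1 := intervalIntegral.integral_hasDerivAt_right hint
    (hmeas.stronglyMeasurable.stronglyMeasurableAtFilter) hc
  have h2 : HasDerivAt (fun y : ℝ => Real.log (1 + y)) (1 / (1 + x)) x :=
    ((hasDerivAt_id x).const_add 1).log (by simp; positivity)
  have h3 := ((Real.hasDerivAt_log hx.ne').const_mul (1 / 2)).mul h2
  have h4 := h1.sub h3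
  have h5 : HasDerivAt Ltilde _ x := h4
  refine h5.congr_deriv ?_
  field_simp
  ring

theorem Yfun_eq {r : ℕ} (b : Fin r → Fin r → ℝ) (n : Fin r → ℕ) (u : Fin r → ℝ) :
    Yfun b n u = Real.exp (Real.sqrt 2 * ∑ i, (n i : ℝ) * wfun b u i) := by
  unfold Yfun
  rw [Finset.mul_sum, Real.exp_sum]
  refine Finset.prod_congr rfl fun i _ => ?_
  rw [← Real.exp_nat_mul]
  ring_nf

theorem upd_hasDerivAt {r : ℕ} (u : Fin r → ℝ) (k j : Fin r) (s : ℝ) :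
    HasDerivAt (fun s => Function.update u k s j) (if j = k then 1 else 0) s := by
  by_cases h : j = k
  · subst h; simpa using hasDerivAt_id' s
  · simpa [h] using hasDerivAt_const s (u j)

theorem Yfun_hasDerivAt {r : ℕ} (b : Fin r → Fin r → ℝ) (n : Fin r → ℕ) (u : Fin r → ℝ)
    (k : Fin r) :
    HasDerivAt (fun s => Yfun b n (Function.update u k s))
      (Yfun b n u * (Real.sqrt 2 * ∑ i, (n i : ℝ) * b k i)) (u k) := by
  have hw : ∀ i, HasDerivAt (fun s => wfun b (Function.update u k s) i) (b k i) (u k) := by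
    intro i
    have := HasDerivAt.fun_sum (u := Finset.univ)
      (fun j _ => (upd_hasDerivAt u k j (u k)).const_mul (b j i))
    simpa [wfun] using this
  have hS := (HasDerivAt.fun_sum (u := Finset.univ)
    (fun i _ => (hw i).const_mul (n i : ℝ))).const_mul (Real.sqrt 2)
  have := hS.exp
  simp only [Function.update_eq_self] at this
  simpa only [Yfun_eq] using this

theorem skew_sum {r : ℕ} (δ : Fin r → ℝ) (b : Fin r → Fin r → ℝ)
    (hskew : ∀ i j, (δ i)⁻¹ * b i j = -((δ j)⁻¹ * b j i)) (n : Fin r → ℕ) :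
    ∑ i, (n i : ℝ) * (δ i)⁻¹ * ∑ j, (n j : ℝ) * b i j = 0 := by
  have h : ∑ i, (n i : ℝ) * (δ i)⁻¹ * ∑ j, (n j : ℝ) * b i j
      = -∑ i, (n i : ℝ) * (δ i)⁻¹ * ∑ j, (n j : ℝ) * b i j := by
    simp only [Finset.mul_sum]
    conv_rhs => rw [Finset.sum_comm]
    simp only [← Finset.sum_neg_distrib]
    refine Finset.sum_congr rfl fun i _ => Finset.sum_congr rfl fun j _ => ?_
    linear_combination (n i : ℝ) * n j * hskew i j
  linarith

/-- Lemma 3.5: the variational formula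
`∂/∂u_k [L̃(Y(u))] = ∑ᵢ p'ᵢ(u) ∂u'ᵢ/∂u_k(u) − p_k(u)` on the small phase space. -/
theorem variational_formula (r : ℕ) (hr : 1 ≤ r)
    (δ : Fin r → ℝ) (hδ : ∀ i, 0 < δ i)
    (b : Fin r → Fin r → ℝ)
    (hskew : ∀ i j, (δ i)⁻¹ * b i j = -((δ j)⁻¹ * b j i))
    (n : Fin r → ℕ) (hn : n ≠ 0)
    (u : Fin r → ℝ) (k : Fin r) :
    deriv (fun s => Ltilde (Yfun b n (Function.update u k s))) (u k)
      = (∑ i, p'fun δ b n u i *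
            deriv (fun s => u'fun δ b n (Function.update u k s) i) (u k))
        - pfun δ b u k := by
  have hYpos : 0 < Yfun b n u := by rw [Yfun_eq]; positivity
  have hY := Yfun_hasDerivAt b n u k
  have hlogY : Real.log (Yfun b n u) = Real.sqrt 2 * ∑ i, (n i : ℝ) * wfun b u i := by
    rw [Yfun_eq, Real.log_exp]
  have hl : HasDerivAt (fun s => Real.log (1 + Yfun b n (Function.update u k s)))
      (Yfun b n u * (Real.sqrt 2 * ∑ i, (n i : ℝ) * b k i) / (1 + Yfun b n u)) (u k) := by
    have := (hY.const_add 1).log (by simp only [Function.update_eq_self]; positivity)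
    simpa only [Function.update_eq_self] using this
  have hL : HasDerivAt (fun s => Ltilde (Yfun b n (Function.update u k s))) _ (u k) :=
    HasDerivAt.comp (u k) (h₂ := Ltilde)
      (by simpa only [Function.update_eq_self] using Ltilde_hasDerivAt _ hYpos) hY
  have hu : ∀ i, deriv (fun s => u'fun δ b n (Function.update u k s) i) (u k) = _ := fun i =>
    ((upd_hasDerivAt u k i (u k)).sub (hl.const_mul ((1 / Real.sqrt 2) * (n i : ℝ) * (δ i)⁻¹))).deriv
  rw [hL.deriv]
  simp only [hu, hlogY]
  have h2 : Real.sqrt 2 * Real.sqrt 2 = 2 := Real.mul_self_sqrt (by norm_num)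
  have h2p : 0 < Real.sqrt 2 := by positivity
  have hs := skew_sum δ b hskew n
  have hp : ∑ i, p'fun δ b n u i * ((n i : ℝ) * (δ i)⁻¹) = ∑ i, (n i : ℝ) * wfun b u i := by
    have : ∀ i, p'fun δ b n u i * ((n i : ℝ) * (δ i)⁻¹) = (n i : ℝ) * wfun b u i
        + (1 / Real.sqrt 2) * Real.log (1 + Yfun b n u) *
          ((n i : ℝ) * (δ i)⁻¹ * ∑ j, (n j : ℝ) * b i j) := by
      intro i
      have := (hδ i).ne'
      unfold p'fun pfun
      field_simp
    simp only [this, Finset.sum_add_distrib, ← Finset.mul_sum, hs]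
    simp
  generalize hc : ∑ i, (n i : ℝ) * b k i = c
  have hsum : ∑ i, p'fun δ b n u i * ((if i = k then 1 else 0) - 1 / Real.sqrt 2 * (n i : ℝ) * (δ i)⁻¹ *
      (Yfun b n u * (Real.sqrt 2 * c) / (1 + Yfun b n u)))
      = p'fun δ b n u k - (∑ i, (n i : ℝ) * wfun b u i) *
        (Yfun b n u * c / (1 + Yfun b n u)) := by
    rw [← hp, Finset.sum_mul]
    have : p'fun δ b n u k = ∑ i, p'fun δ b n u i * (if i = k then 1 else 0) := by simp
    rw [this, ← Finset.sum_sub_distrib]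
    refine Finset.sum_congr rfl fun i _ => ?_
    field_simp
  rw [hsum]
  unfold p'fun
  rw [hc]
  generalize ∑ i, (n i : ℝ) * wfun b u i = S
  generalize Real.log (1 + Yfun b n u) = l
  have hi : 1 / Real.sqrt 2 = Real.sqrt 2 / 2 := by
    field_simp; linarith
  rw [hi]
  generalize Yfun b n u = Y at *
  have : 1 + Y ≠ 0 := by positivity
  field_simp
  linear_combination (-(Y * S * c)) * h2
end

section
/- Define Φ : (0,∞)² → (0,∞)² by Φ(y₁, y₂) = (y₂(1+y₁), 1/y₁). Then Φ is a bijection of (0,∞)² of order exactly 5; in particular the fifth iterate Φ⁵ is the identity map on (0,∞)². -/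
/-- The positive quadrant `(0,∞)²`. -/
def PosQuadrant := {p : ℝ × ℝ // 0 < p.1 ∧ 0 < p.2}

/-- The type A₂ mutation map `Φ(y₁, y₂) = (y₂(1+y₁), 1/y₁)` on `(0,∞)²`. -/
noncomputable def Phi (p : PosQuadrant) : PosQuadrant :=
  ⟨(p.1.2 * (1 + p.1.1), 1 / p.1.1),
   ⟨mul_pos p.2.2 (by have := p.2.1; linarith), one_div_pos.mpr p.2.1⟩⟩

theorem Phi_five : Phi^[5] = id := by
  funext p
  obtain ⟨⟨a, b⟩, ha, hb⟩ := p
  simp only at ha hb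
  apply Subtype.ext
  simp only [Function.iterate_succ, Function.iterate_zero, Function.comp, Phi, id]
  have h1 : 1 + a ≠ 0 := by positivity
  have h2 : 1 + b ≠ 0 := by positivity
  have h3 : a + b * (1 + a) + 1 ≠ 0 := by positivity
  have e2 : 1 / a * (1 + b * (1 + a)) = (1 + b * (1 + a)) / a := by ring
  have h4 : 1 + b * (1 + a) ≠ 0 := by positivity
  have e3 : 1 / (b * (1 + a)) * (1 + (1 + b * (1 + a)) / a) = (1 + b) / (a * b) := by
    field_simp
    ring
  have e4 : 1 / ((1 + b * (1 + a)) / a) * (1 + (1 + b) / (a * b)) = 1 / b := by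
    field_simp
    ring
  have e5 : 1 / ((1 + b) / (a * b)) * (1 + 1 / b) = a := by
    field_simp
    ring
  rw [e2, e3, e4, e5]
  simp

/-- Pentagon periodicity: `Φ` is a bijection of `(0,∞)²` of order exactly 5. -/
theorem pentagon_periodicity :
    Function.Bijective Phi ∧ Phi^[5] = id ∧
      ∀ k : ℕ, 0 < k → k < 5 → Phi^[k] ≠ id := by
  refine ⟨?_, Phi_five, ?_⟩
  · have h : ∀ p, Phi^[5] p = p := fun p => congrFun Phi_five p
    refine Function.bijective_iff_has_inverse.mpr ⟨Phi^[4], fun p => ?_, fun p => ?_⟩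
    · exact h p
    · rw [← Function.iterate_succ_apply' Phi 4 p]
      exact h p
  · intro k h0 h5 hk
    have h := congrArg (fun q : PosQuadrant => q.1.1)
      (congrFun hk ⟨(1, 2), by norm_num, by norm_num⟩)
    change (Phi^[k] ⟨(1, 2), by norm_num, by norm_num⟩).1.1 = (1 : ℝ) at h
    interval_cases k <;>
      norm_num [Function.iterate_succ, Function.comp, Phi] at h
end

section
/- Let Ω : ℝ² × ℝ² → ℝ be the skew-symmetric bilinear form with Ω(e₂, e₁) = 1 (so Ω(e₁, e₂) = −1), and for a nonzero n ∈ (ℤ≥0)² let S_n : (0,∞)² → (0,∞)² be defined by (S_n(y))_i = y_i (1 + y^n)^{Ω(n, e_i)}, where y^n = y₁^{n₁} y₂^{n₂}. Then the type B₂ consistency relation holds as an identity of maps (0,∞)² → (0,∞)²: S_{(1,0)} ∘ S_{(0,1)} ∘ S_{(0,1)} = S_{(0,1)} ∘ S_{(0,1)} ∘ S_{(1,2)} ∘ S_{(1,1)} ∘ S_{(1,1)} ∘ S_{(1,0)}. -/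
/-- The positive quadrant `(0,∞)²` as points of `ℝ²`. -/
def PosOrthant2 := {y : Fin 2 → ℝ // ∀ i, 0 < y i}

/-- The skew-symmetric bilinear form on `ℝ²` with `Ω(e₂, e₁) = 1`. -/
def omB2 (v w : Fin 2 → ℝ) : ℝ := v 1 * w 0 - v 0 * w 1

/-- The point map `S_n` on the positive quadrant:
`(S_n(y))_i = y_i (1 + y^n)^{Ω(n, e_i)}` where `y^n = y₁^{n₁} y₂^{n₂}`. -/
noncomputable def SB2 (n : Fin 2 → ℕ) (y : PosOrthant2) : PosOrthant2 :=
  ⟨fun i => y.1 i * (1 + ∏ j, y.1 j ^ (n j)) ^ (omB2 (fun j => (n j : ℝ)) (Pi.single i 1)),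
   fun i => mul_pos (y.2 i) (Real.rpow_pos_of_pos
      (by
        have h : 0 < ∏ j, y.1 j ^ (n j) :=
          Finset.prod_pos fun j _ => pow_pos (y.2 j) _
        linarith) _)⟩

theorem SB2_coord (n : Fin 2 → ℕ) (y : PosOrthant2) :
    (SB2 n y).1 0 = y.1 0 * (1 + y.1 0 ^ n 0 * y.1 1 ^ n 1) ^ n 1 ∧
    (SB2 n y).1 1 = y.1 1 / (1 + y.1 0 ^ n 0 * y.1 1 ^ n 1) ^ n 0 := by
  have h0 := y.2 0
  have h1 := y.2 1
  have hp : 0 < 1 + y.1 0 ^ n 0 * y.1 1 ^ n 1 := by positivity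
  constructor
  · simp [SB2, omB2, Fin.prod_univ_two]
  · simp [SB2, omB2, Fin.prod_univ_two, Real.rpow_neg hp.le, div_eq_mul_inv]

theorem SB2_mk (n : Fin 2 → ℕ) (y : PosOrthant2) (a b c d : ℝ)
    (ha : y.1 0 = a) (hb : y.1 1 = b)
    (hc : a * (1 + a ^ n 0 * b ^ n 1) ^ n 1 = c)
    (hd : b / (1 + a ^ n 0 * b ^ n 1) ^ n 0 = d) :
    (SB2 n y).1 0 = c ∧ (SB2 n y).1 1 = d := by
  subst ha hb hc hd
  exact SB2_coord n y

/-- The type B₂ consistency relation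
`Ψ[e₂]²Ψ[e₁] = Ψ[e₁]Ψ[(1,1)]²Ψ[(1,2)]Ψ[e₂]²` in the `y`-representation. -/
theorem B2_consistency :
    SB2 ![1, 0] ∘ SB2 ![0, 1] ∘ SB2 ![0, 1]
      = SB2 ![0, 1] ∘ SB2 ![0, 1] ∘ SB2 ![1, 2] ∘ SB2 ![1, 1] ∘ SB2 ![1, 1] ∘ SB2 ![1, 0] := by
  funext y
  have hx := y.2 0
  have hz := y.2 1
  obtain ⟨x, hx'⟩ : ∃ x, x = y.1 0 := ⟨_, rfl⟩
  obtain ⟨z, hz'⟩ : ∃ z, z = y.1 1 := ⟨_, rfl⟩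
  rw [← hx'] at hx
  rw [← hz'] at hz
  have L1 := SB2_mk ![0, 1] y x z (x * (1 + z)) z hx'.symm hz'.symm (by simp) (by simp)
  have L2 := SB2_mk ![0, 1] _ _ _ (x * (1 + z) ^ 2) z L1.1 L1.2 (by simp; ring) (by simp)
  have L3 := SB2_mk ![1, 0] _ _ _ (x * (1 + z) ^ 2) (z / (1 + x * (1 + z) ^ 2)) L2.1 L2.2
    (by simp) (by simp)
  have hD : 0 < 1 + x + x * z := by positivity
  have hA : 0 < 1 + x * (1 + z) ^ 2 := by positivity
  have R1 := SB2_mk ![1, 0] y x z x (z / (1 + x)) hx'.symm hz'.symm (by simp) (by simp)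
  have R2 := SB2_mk ![1, 1] _ _ _ (x * (1 + x + x * z) / (1 + x)) (z / (1 + x + x * z)) R1.1 R1.2
    (by simp; field_simp) (by simp; field_simp)
  have R3 := SB2_mk ![1, 1] _ _ _ (x * (1 + x + x * z) ^ 2 / (1 + x) ^ 2)
    (z * (1 + x) / (1 + x + x * z) ^ 2) R2.1 R2.2
    (by simp; field_simp) (by simp; field_simp)
  have e : 1 + (x * (1 + x + x * z) ^ 2 / (1 + x) ^ 2) * (z * (1 + x) / (1 + x + x * z) ^ 2) ^ 2
      = (1 + x) * (1 + x * (1 + z) ^ 2) / (1 + x + x * z) ^ 2 := by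
    field_simp
    ring
  have R4 := SB2_mk ![1, 2] _ _ _ (x * (1 + x * (1 + z) ^ 2) ^ 2 / (1 + x + x * z) ^ 2)
    (z / (1 + x * (1 + z) ^ 2)) R3.1 R3.2
    (by
      simp only [Matrix.cons_val_zero, Matrix.cons_val_one, pow_one]
      rw [e]; field_simp)
    (by
      simp only [Matrix.cons_val_zero, Matrix.cons_val_one, pow_one]
      rw [e]; field_simp)
  have R5 := SB2_mk ![0, 1] _ _ _
    (x * (1 + x * (1 + z) ^ 2) * (1 + z) / (1 + x + x * z)) (z / (1 + x * (1 + z) ^ 2)) R4.1 R4.2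
    (by simp; field_simp; ring) (by simp)
  have R6 := SB2_mk ![0, 1] _ _ _ (x * (1 + z) ^ 2) (z / (1 + x * (1 + z) ^ 2)) R5.1 R5.2
    (by simp; field_simp; ring) (by simp)
  apply Subtype.ext
  funext i
  fin_cases i
  · exact L3.1.trans R6.1.symm
  · exact L3.2.trans R6.2.symm
end

section
/- Fix real numbers a > 0 and b > 0 and set y₁ = t·a, y₂ = t·b for t > 0. Define D(t) = L̃(y₂ + 2y₁y₂) + L̃(y₁) − L̃(y₁ − 2y₁y₂) − 2·L̃(y₁y₂) − L̃(y₂), which is defined for all sufficiently small t > 0 (so that y₁ − 2y₁y₂ > 0). Then D(t)/t² → 0 as t → 0⁺. -/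
open Filter Topology Asymptotics in
theorem Lt_aux1 {x : ℝ} (h0 : 0 < x) (h1 : x ≤ 1/2) :
    |Real.log (1+x) - x + x^2/2| ≤ 2 * x^3 := by
  have h := Real.abs_log_sub_add_sum_range_le (x := -x) (by rw [abs_neg, abs_of_pos h0]; linarith) 2
  rw [abs_neg, abs_of_pos h0] at h
  simp only [Finset.sum_range_succ, Finset.sum_range_zero] at h
  have e : Real.log (1+x) - x + x^2/2 = (0 + (-x)^(0+1)/((0:ℕ)+1) + (-x)^(1+1)/((1:ℕ)+1)) + Real.log (1 - -x) := by
    rw [sub_neg_eq_add]; push_cast; ring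
  rw [e]
  refine h.trans ?_
  rw [div_le_iff₀ (by linarith)]
  have : 0 < x^3 := by positivity
  norm_num
  nlinarith

theorem Lt_aux2 {x : ℝ} (h0 : 0 < x) (h1 : x ≤ 1/2) :
    |(∫ t in (0 : ℝ)..x, Real.log (1 + t) / t) - (x - x^2/4)| ≤ 2 * x^3 := by
  have hb : ∀ t ∈ Set.uIoc 0 x, ‖Real.log (1+t)/t - (1 - t/2)‖ ≤ 2 * x^2 := by
    intro t ht
    rw [Set.uIoc_of_le h0.le] at ht
    obtain ⟨ht0, htx⟩ := ht
    have h := Lt_aux1 ht0 (htx.trans h1)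
    have e : Real.log (1+t)/t - (1 - t/2) = (Real.log (1+t) - t + t^2/2)/t := by
      field_simp
      ring
    rw [e, Real.norm_eq_abs, abs_div, abs_of_pos ht0, div_le_iff₀ ht0]
    have : t^2 ≤ x^2 := by gcongr
    nlinarith
  have hm : Measurable (fun t : ℝ => Real.log (1+t)/t - (1 - t/2)) := by fun_prop
  have hi : IntervalIntegrable (fun t : ℝ => Real.log (1+t)/t - (1 - t/2)) MeasureTheory.volume 0 x := by
    rw [intervalIntegrable_iff]
    refine MeasureTheory.Measure.integrableOn_of_bounded (M := 2*x^2) (by simp) hm.aestronglyMeasurable ?_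
    exact (MeasureTheory.ae_restrict_iff' measurableSet_uIoc).2 (Filter.Eventually.of_forall hb)
  have hp : IntervalIntegrable (fun t : ℝ => 1 - t/2) MeasureTheory.volume 0 x :=
    Continuous.intervalIntegrable (by fun_prop) _ _
  have hpi : ∫ t in (0:ℝ)..x, (1 - t/2) = x - x^2/4 := by
    rw [intervalIntegral.integral_sub (by simp) (Continuous.intervalIntegrable (by fun_prop) _ _)]
    simp [intervalIntegral.integral_div]
    ring
  have hs := intervalIntegral.integral_add hi hp
  simp only [sub_add_cancel] at hs
  rw [hs, hpi, add_sub_cancel_right]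
  have := intervalIntegral.norm_integral_le_of_norm_le_const hb
  rw [Real.norm_eq_abs, sub_zero, abs_of_pos h0] at this
  linarith [this, (by ring : 2 * x^2 * x = 2 * x^3)]

noncomputable def LtP (x : ℝ) : ℝ := x - x^2/4 - (1/2) * Real.log x * (x - x^2/2)

open Filter Topology Asymptotics in
theorem Lt_aux3 : (fun x => Ltilde x - LtP x) =o[𝓝[>] 0] (fun x : ℝ => x^2) := by
  have hxl : Tendsto (fun x : ℝ => 2 * x + |x * Real.log x|) (𝓝[>] 0) (𝓝 0) := by
    have : Continuous (fun x : ℝ => 2 * x + |x * Real.log x|) :=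
      (continuous_const.mul continuous_id).add Real.continuous_mul_log.abs
    have h := (this.tendsto 0).mono_left (nhdsWithin_le_nhds (s := Set.Ioi 0))
    simpa using h
  have h1 : (fun x => Ltilde x - LtP x) =O[𝓝[>] 0] (fun x : ℝ => (2 * x + |x * Real.log x|) * x^2) := by
    refine IsBigO.of_bound 1 ?_
    have hm : Set.Ioc (0:ℝ) (1/2) ∈ 𝓝[>] (0:ℝ) := Ioc_mem_nhdsGT (by norm_num)
    filter_upwards [hm] with x hx
    have a1 := Lt_aux1 hx.1 hx.2
    have a2 := Lt_aux2 hx.1 hx.2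
    have e : Ltilde x - LtP x = ((∫ t in (0 : ℝ)..x, Real.log (1 + t) / t) - (x - x^2/4)) - (1/2) * Real.log x * (Real.log (1+x) - x + x^2/2) := by
      unfold Ltilde LtP; ring
    have hx0 := hx.1
    rw [one_mul, Real.norm_eq_abs, Real.norm_eq_abs, abs_of_nonneg (by positivity : 0 ≤ (2 * x + |x * Real.log x|) * x^2), e]
    refine (abs_sub _ _).trans ?_
    rw [abs_mul, abs_mul, abs_mul, abs_of_pos hx0, abs_of_pos (by norm_num : (0:ℝ) < 1/2)]
    have := mul_le_mul_of_nonneg_left a1 (by positivity : 0 ≤ 1/2 * |Real.log x|)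
    linarith
  refine h1.trans_isLittleO ?_
  have := ((isLittleO_one_iff ℝ).2 hxl).mul_isBigO (isBigO_refl (fun x : ℝ => x^2) (𝓝[>] 0))
  simpa using this

open Filter Topology Asymptotics in
theorem Lt_aux4 (c : ℝ → ℝ) (hc : Continuous c) (h0 : c 0 = 0) (hp : ∀ᶠ t in 𝓝[>] (0:ℝ), 0 < c t)
    (hO : c =O[𝓝[>] 0] (fun t : ℝ => t)) :
    Tendsto (fun t => (Ltilde (c t) - LtP (c t)) / t^2) (𝓝[>] 0) (𝓝 0) := by
  have ht : Tendsto c (𝓝[>] 0) (𝓝[>] 0) := by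
    refine tendsto_nhdsWithin_iff.2 ⟨?_, hp⟩
    have := (hc.tendsto 0).mono_left (nhdsWithin_le_nhds (s := Set.Ioi 0))
    rwa [h0] at this
  exact ((Lt_aux3.comp_tendsto ht).trans_isBigO (hO.pow 2)).tendsto_div_nhds_zero

open Filter Topology Asymptotics in
theorem Lt_aux5 (k : ℝ) : Tendsto (fun t : ℝ => Real.log (1 + k * t) / t) (𝓝[>] 0) (𝓝 k) := by
  have h : HasDerivAt (fun t : ℝ => Real.log (1 + k * t)) k 0 := by
    have h1 : HasDerivAt (fun t : ℝ => 1 + k * t) k 0 := by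
      simpa using ((hasDerivAt_id (0:ℝ)).const_mul k).const_add 1
    simpa using h1.log (by simp)
  have := h.tendsto_slope_zero_right
  refine this.congr fun t => ?_
  simp [div_eq_inv_mul]

open Filter Topology Asymptotics in
theorem Lt_aux6 (c : ℝ → ℝ) (m : ℝ → ℝ) (hm : Continuous m) (h : ∀ t, c t = m t * t) :
    c =O[𝓝[>] 0] (fun t : ℝ => t) := by
  have h1 : m =O[𝓝[>] 0] (fun _ => (1:ℝ)) :=
    ((hm.tendsto 0).mono_left nhdsWithin_le_nhds).isBigO_one ℝ
  have := h1.mul (isBigO_refl (fun t : ℝ => t) (𝓝[>] 0))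
  simp only [one_mul] at this
  exact this.congr_left fun t => (h t).symm

open Filter Topology Asymptotics in
theorem Lt_aux7 (a b : ℝ) (ha : 0 < a) (hb : 0 < b) :
    Tendsto (fun t : ℝ => (LtP (t * b + 2 * (t * a) * (t * b)) + LtP (t * a)
          - LtP (t * a - 2 * (t * a) * (t * b))
          - 2 * LtP ((t * a) * (t * b)) - LtP (t * b)) / t ^ 2) (𝓝[>] 0) (𝓝 0) := by
  have hv : Tendsto (fun t : ℝ => t * Real.log t) (𝓝[>] 0) (𝓝 0) := by
    simpa using (Real.continuous_mul_log.tendsto 0).mono_left (nhdsWithin_le_nhds (s := Set.Ioi 0))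
  have ht : Tendsto (fun t : ℝ => t) (𝓝[>] 0) (𝓝 0) := nhdsWithin_le_nhds
  have hr := Lt_aux5 (2*a)
  have hs := Lt_aux5 (-(2*b))
  set A := Real.log a with hA
  set B := Real.log b with hB
  let G : ℝ × ℝ × ℝ × ℝ → ℝ := fun z =>
    2*a*b - 1/4 * (b^2*((1+2*z.1*a)^2-1) + a^2*(1-(1-2*z.1*b)^2) - 2*z.1^2*a^2*b^2)
    - 1/2 * (b*(1+2*z.1*a)*z.2.2.1 - a*(1-2*z.1*b)*z.2.2.2)
    + 1/4 * (b^2*((4*a+4*z.1*a^2)*(z.2.1+z.1*B) + (1+2*z.1*a)^2*(z.1*z.2.2.1))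
      + a^2*((4*b-4*z.1*b^2)*(z.2.1+z.1*A) - (1-2*z.1*b)^2*(z.1*z.2.2.2))
      - 2*z.1*a^2*b^2*(2*z.2.1+z.1*A+z.1*B))
  have hG : Continuous G := by fun_prop
  have hlim := (hG.tendsto (0, 0, 2*a, -(2*b))).comp
    (ht.prodMk_nhds (hv.prodMk_nhds (hr.prodMk_nhds hs)))
  have e0 : G (0, 0, 2*a, -(2*b)) = 0 := by simp only [G]; ring
  rw [e0] at hlim
  refine hlim.congr' ?_
  have hm : Set.Ioo (0:ℝ) (1/(2*b)) ∈ 𝓝[>] (0:ℝ) := Ioo_mem_nhdsGT (by positivity)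
  filter_upwards [hm] with t htt
  obtain ⟨t0, t1⟩ := htt
  rw [lt_div_iff₀ (by positivity)] at t1
  have q0 : 0 < 1 + -(2*b)*t := by linarith
  have p0 : 0 < 1 + 2*a*t := by positivity
  have l1 : Real.log (t * b + 2 * (t * a) * (t * b)) = Real.log t + B + Real.log (1+2*a*t) := by
    rw [hB, ← Real.log_mul t0.ne' hb.ne', ← Real.log_mul (by positivity) p0.ne']; congr 1; ring
  have l2 : Real.log (t * a - 2 * (t * a) * (t * b)) = Real.log t + A + Real.log (1+ -(2*b)*t) := by
    rw [hA, ← Real.log_mul t0.ne' ha.ne', ← Real.log_mul (by positivity) q0.ne']; congr 1; ring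
  have l3 : Real.log (t*a) = Real.log t + A := Real.log_mul t0.ne' ha.ne'
  have l4 : Real.log (t*b) = Real.log t + B := Real.log_mul t0.ne' hb.ne'
  have l5 : Real.log (t*a*(t*b)) = (Real.log t + A) + (Real.log t + B) := by
    rw [Real.log_mul (by positivity) (by positivity), l3, l4]
  simp only [LtP, G, Function.comp, l1, l2, l3, l4, l5]
  generalize Real.log (1+2*a*t) = p
  generalize Real.log (1+ -(2*b)*t) = q
  generalize Real.log t = u
  clear_value A B
  field_simp
  ring

open Filter Topology Asymptotics in
theorem A1affine_reduced_DI_deg2 (a b : ℝ) (ha : 0 < a) (hb : 0 < b) :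
    Filter.Tendsto
      (fun t : ℝ =>
        (Ltilde (t * b + 2 * (t * a) * (t * b)) + Ltilde (t * a)
          - Ltilde (t * a - 2 * (t * a) * (t * b))
          - 2 * Ltilde ((t * a) * (t * b)) - Ltilde (t * b)) / t ^ 2)
      (nhdsWithin 0 (Set.Ioi 0)) (nhds 0) := by
  have hpos : ∀ᶠ t in 𝓝[>] (0:ℝ), 0 < t := self_mem_nhdsWithin
  have k1 := Lt_aux4 (fun t => t * b + 2 * (t * a) * (t * b)) (by fun_prop) (by simp)
    (by filter_upwards [hpos] with t ht; positivity)
    (Lt_aux6 _ (fun t => b + 2 * a * (t * b)) (by fun_prop) (fun t => by ring))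
  have k2 := Lt_aux4 (fun t => t * a) (by fun_prop) (by simp)
    (by filter_upwards [hpos] with t ht; positivity)
    (Lt_aux6 _ (fun t => a) (by fun_prop) (fun t => by ring))
  have k3 := Lt_aux4 (fun t => t * a - 2 * (t * a) * (t * b)) (by fun_prop) (by simp)
    (by
      have hm : Set.Ioo (0:ℝ) (1/(2*b)) ∈ 𝓝[>] (0:ℝ) := Ioo_mem_nhdsGT (by positivity)
      filter_upwards [hm] with t htt
      obtain ⟨t0, t1⟩ := htt
      rw [lt_div_iff₀ (by positivity)] at t1
      have : 0 < t * a * (1 - t * (2 * b)) := mul_pos (by positivity) (by linarith)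
      linarith)
    (Lt_aux6 _ (fun t => a - 2 * a * (t * b)) (by fun_prop) (fun t => by ring))
  have k4 := Lt_aux4 (fun t => (t * a) * (t * b)) (by fun_prop) (by simp)
    (by filter_upwards [hpos] with t ht; positivity)
    (Lt_aux6 _ (fun t => a * (t * b)) (by fun_prop) (fun t => by ring))
  have k5 := Lt_aux4 (fun t => t * b) (by fun_prop) (by simp)
    (by filter_upwards [hpos] with t ht; positivity)
    (Lt_aux6 _ (fun t => b) (by fun_prop) (fun t => by ring))
  have k := ((((k1.add k2).sub k3).sub (k4.const_mul 2)).sub k5).add (Lt_aux7 a b ha hb)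
  simp only [mul_zero, sub_zero, add_zero] at k
  refine k.congr fun t => ?_
  ring
end

section
/- Fix real numbers a > 0 and b > 0 and set y₁ = t·a, y₂ = t·b for t > 0. Define D(t) = L̃(y₂ + 2y₁y₂ + y₁²y₂) + L̃(y₁) − L̃(y₁ − 2y₁y₂ − 4y₁²y₂ + 3y₁y₂²) − L̃(y₁²y₂) − 2·L̃(y₁y₂ − 2y₁y₂²) − L̃(y₁y₂²) − L̃(y₂), which is defined for all sufficiently small t > 0 (so that all arguments are positive). Then D(t)/t³ → 0 as t → 0⁺. -/
open Filter Topology Asymptotics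

/-- third order jet at `0+` with zero constant term, modulo `O(t^4)` -/
def Jet (f : ℝ → ℝ) (p q r : ℝ) : Prop :=
  (fun t => f t - (p * t + q * t ^ 2 + r * t ^ 3)) =O[𝓝[>] (0:ℝ)] (fun t : ℝ => t ^ 4)

lemma bigO_one_of_cont {h : ℝ → ℝ} (hh : Continuous h) :
    h =O[𝓝[>] (0:ℝ)] (fun _ => (1:ℝ)) :=
  (hh.tendsto 0 |>.mono_left nhdsWithin_le_nhds).isBigO_one ℝ

lemma bigO_t4 {h : ℝ → ℝ} (hh : Continuous h) :
    (fun t => t ^ 4 * h t) =O[𝓝[>] (0:ℝ)] (fun t : ℝ => t ^ 4) := by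
  simpa using (isBigO_refl (fun t : ℝ => t ^ 4) (𝓝[>] (0:ℝ))).mul (bigO_one_of_cont hh)

lemma Jet.add {f g : ℝ → ℝ} {p q r p' q' r' : ℝ} (hf : Jet f p q r) (hg : Jet g p' q' r') :
    Jet (fun t => f t + g t) (p + p') (q + q') (r + r') := by
  unfold Jet at *
  refine (IsBigO.add hf hg).congr_left fun t => ?_
  ring

lemma Jet.smul {f : ℝ → ℝ} {p q r : ℝ} (c : ℝ) (hf : Jet f p q r) :
    Jet (fun t => c * f t) (c * p) (c * q) (c * r) := by
  unfold Jet at *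
  refine (IsBigO.const_mul_left hf c).congr_left fun t => ?_
  ring

lemma t4_one : (fun t : ℝ => t ^ 4) =O[𝓝[>] (0:ℝ)] (fun _ => (1:ℝ)) :=
  bigO_one_of_cont (by fun_prop)

lemma Jet.bdd {f : ℝ → ℝ} {p q r : ℝ} (hf : Jet f p q r) :
    f =O[𝓝[>] (0:ℝ)] (fun _ => (1:ℝ)) := by
  have h1 := IsBigO.trans hf t4_one
  have h2 : (fun t : ℝ => p * t + q * t ^ 2 + r * t ^ 3) =O[𝓝[>] (0:ℝ)] (fun _ => (1:ℝ)) :=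
    bigO_one_of_cont (by fun_prop)
  refine (h1.add h2).congr_left fun t => ?_
  ring

lemma Jet.mul {f g : ℝ → ℝ} {p q r p' q' r' : ℝ} (hf : Jet f p q r) (hg : Jet g p' q' r') :
    Jet (fun t => f t * g t) 0 (p * p') (p * q' + q * p') := by
  have h1 := hf.bdd.mul hg
  have h2 : (fun t : ℝ => p' * t + q' * t ^ 2 + r' * t ^ 3) =O[𝓝[>] (0:ℝ)] (fun _ => (1:ℝ)) :=
    bigO_one_of_cont (by fun_prop)
  have h3 := IsBigO.mul hf h2
  have h4 : (fun t : ℝ => t ^ 4 * (p * r' + q * q' + r * p' + t * (q * r' + r * q')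
    + t ^ 2 * (r * r'))) =O[𝓝[>] (0:ℝ)] (fun t : ℝ => t ^ 4) := bigO_t4 (by fun_prop)
  simp only [one_mul, mul_one] at h1 h3
  refine ((h1.add h3).add h4).congr_left fun t => ?_
  ring

lemma log_cub {u : ℝ} (hu : |u| ≤ 1 / 2) :
    |Real.log (1 + u) - (u - u ^ 2 / 2 + u ^ 3 / 3)| ≤ 2 * |u| ^ 4 := by
  have h := Real.abs_log_sub_add_sum_range_le (x := -u) (by rw [abs_neg]; linarith) 3
  simp only [Finset.sum_range_succ, Finset.sum_range_zero, abs_neg, sub_neg_eq_add] at h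
  have h2 : |u| ^ (3 + 1) / (1 - |u|) ≤ 2 * |u| ^ 4 := by
    rw [div_le_iff₀ (by linarith)]
    have : 0 ≤ |u| ^ 4 := by positivity
    norm_num
    nlinarith
  refine le_trans (le_of_eq ?_) (h.trans h2)
  congr 1
  push_cast
  ring

lemma int_cub {x : ℝ} (hx : 0 < x) (hx2 : x ≤ 1 / 2) :
    |(∫ t in (0 : ℝ)..x, Real.log (1 + t) / t) - (x - x ^ 2 / 4 + x ^ 3 / 9)| ≤ 2 * |x| ^ 4 := by
  have key : ∀ t ∈ Set.uIoc 0 x,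
      ‖Real.log (1 + t) / t - (1 - t / 2 + t ^ 2 / 3)‖ ≤ 2 * x ^ 3 := by
    intro t ht
    rw [Set.uIoc_of_le hx.le] at ht
    have ht0 := ht.1
    have h := log_cub (u := t) (by rw [abs_of_pos ht0]; linarith [ht.2])
    have e : Real.log (1 + t) / t - (1 - t / 2 + t ^ 2 / 3)
        = (Real.log (1 + t) - (t - t ^ 2 / 2 + t ^ 3 / 3)) / t := by
      field_simp
    rw [e, Real.norm_eq_abs, abs_div, abs_of_pos ht0, div_le_iff₀ ht0]
    rw [abs_of_pos ht0] at h
    have : t ^ 3 ≤ x ^ 3 := pow_le_pow_left₀ ht0.le ht.2 3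
    nlinarith
  have hp : IntervalIntegrable (fun t : ℝ => 1 - t / 2 + t ^ 2 / 3) MeasureTheory.volume 0 x :=
    Continuous.intervalIntegrable (by fun_prop) _ _
  have hd : IntervalIntegrable (fun t : ℝ => Real.log (1 + t) / t - (1 - t / 2 + t ^ 2 / 3))
      MeasureTheory.volume 0 x := by
    rw [intervalIntegrable_iff]
    refine MeasureTheory.Measure.integrableOn_of_bounded (M := 2 * x ^ 3) ?_ ?_ ?_
    · simp
    · exact (by fun_prop : Measurable _).aestronglyMeasurable
    · exact (MeasureTheory.ae_restrict_iff' measurableSet_uIoc).2 (Eventually.of_forall key)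
  have hl : IntervalIntegrable (fun t : ℝ => Real.log (1 + t) / t) MeasureTheory.volume 0 x := by
    have := hd.add hp
    refine this.congr ?_
    intro t _
    simp
  have hI : (∫ t in (0 : ℝ)..x, (1 - t / 2 + t ^ 2 / 3)) = x - x ^ 2 / 4 + x ^ 3 / 9 := by
    rw [intervalIntegral.integral_add, intervalIntegral.integral_sub]
    · simp
      ring
    all_goals exact Continuous.intervalIntegrable (by fun_prop) _ _
  rw [← hI, ← intervalIntegral.integral_sub hl hp, ← Real.norm_eq_abs]
  refine (intervalIntegral.norm_integral_le_of_norm_le_const key).trans (le_of_eq ?_)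
  rw [abs_of_pos hx, sub_zero, abs_of_pos hx]
  ring

lemma jet_comp {G : ℝ → ℝ} (k m v w z : ℝ) 
    (hG : ∀ᶠ t in 𝓝[>] (0:ℝ), |G t - ((v * t + w * t ^ 2 + z * t ^ 3)
      - k * (v * t + w * t ^ 2 + z * t ^ 3) ^ 2 + m * (v * t + w * t ^ 2 + z * t ^ 3) ^ 3)|
      ≤ 2 * |v * t + w * t ^ 2 + z * t ^ 3| ^ 4) :
    Jet G v (w - k * v ^ 2) (z - 2 * k * v * w + m * v ^ 3) := by
  have h1 : (fun t => G t - ((v * t + w * t ^ 2 + z * t ^ 3)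
      - k * (v * t + w * t ^ 2 + z * t ^ 3) ^ 2 + m * (v * t + w * t ^ 2 + z * t ^ 3) ^ 3))
      =O[𝓝[>] (0:ℝ)] (fun t : ℝ => t ^ 4 * (v + w * t + z * t ^ 2) ^ 4) := by
    refine IsBigO.of_bound 2 (hG.mono fun t ht => ?_)
    rw [Real.norm_eq_abs, Real.norm_eq_abs]
    refine ht.trans (le_of_eq ?_)
    rw [← abs_pow]
    congr 2
    ring
  have h2 := h1.trans (bigO_t4 (by fun_prop))
  have h3 : (fun t : ℝ => t ^ 4 * (-k * ((w ^ 2 + 2 * v * z) + 2 * w * z * t + z ^ 2 * t ^ 2)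
      + m * (3 * v ^ 2 * (w + t * z) + 3 * v * (w + t * z) ^ 2 * t + (w + t * z) ^ 3 * t ^ 2)))
      =O[𝓝[>] (0:ℝ)] (fun t : ℝ => t ^ 4) := bigO_t4 (by fun_prop)
  refine (h2.add h3).congr_left fun t => ?_
  ring

lemma ev_small (v w z : ℝ) : ∀ᶠ t in 𝓝[>] (0:ℝ), |v * t + w * t ^ 2 + z * t ^ 3| ≤ 1 / 2 := by
  have hc : Continuous (fun t : ℝ => |v * t + w * t ^ 2 + z * t ^ 3|) := by fun_prop
  have := (hc.tendsto 0).mono_left (nhdsWithin_le_nhds (s := Set.Ioi 0))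
  have h2 : |v * 0 + w * 0 ^ 2 + z * 0 ^ 3| < (1 / 2 : ℝ) := by simp
  exact (this.eventually (gt_mem_nhds h2)).mono fun t ht => le_of_lt ht

lemma ev_pos {g : ℝ → ℝ} (hg : Continuous g) (h0 : 0 < g 0) : ∀ᶠ t in 𝓝[>] (0:ℝ), 0 < g t :=
  ((hg.tendsto 0).mono_left (nhdsWithin_le_nhds (s := Set.Ioi 0))).eventually (lt_mem_nhds h0)

lemma jet_log {u : ℝ → ℝ} (v w z : ℝ) (hu : ∀ t, u t = v * t + w * t ^ 2 + z * t ^ 3) :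
    Jet (fun t => Real.log (1 + u t)) v (w - 1 / 2 * v ^ 2)
      (z - 2 * (1 / 2) * v * w + 1 / 3 * v ^ 3) := by
  refine jet_comp _ _ _ _ _ ((ev_small v w z).mono fun t ht => ?_)
  rw [hu]
  refine le_trans (le_of_eq ?_) (log_cub ht)
  congr 1
  ring

lemma jet_int {u : ℝ → ℝ} (v w z : ℝ) (hu : ∀ t, u t = v * t + w * t ^ 2 + z * t ^ 3)
    (hp : ∀ᶠ t in 𝓝[>] (0:ℝ), 0 < u t) :
    Jet (fun t => ∫ s in (0:ℝ)..u t, Real.log (1 + s) / s) v (w - 1 / 4 * v ^ 2)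
      (z - 2 * (1 / 4) * v * w + 1 / 9 * v ^ 3) := by
  refine jet_comp _ _ _ _ _ (((ev_small v w z).and hp).mono fun t ht => ?_)
  obtain ⟨h1, h2⟩ := ht
  rw [hu] at h2 ⊢
  refine le_trans (le_of_eq ?_) (int_cub h2 ((le_abs_self _).trans h1))
  congr 1
  ring

lemma Jet.zero {f : ℝ → ℝ} {p q r : ℝ} (hf : Jet f p q r) (hp : p = 0) (hq : q = 0)
    (hr : r = 0) : f =O[𝓝[>] (0:ℝ)] (fun t : ℝ => t ^ 4) := by
  subst hp hq hr
  exact IsBigO.congr_left hf fun t => by ring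

lemma lim_of_bigO {f : ℝ → ℝ} (hf : f =O[𝓝[>] (0:ℝ)] (fun t : ℝ => t ^ 4)) (g : ℝ → ℝ)
    (hg : Tendsto (fun t => g t * t) (𝓝[>] (0:ℝ)) (𝓝 0)) :
    Tendsto (fun t => g t * f t / t ^ 3) (𝓝[>] (0:ℝ)) (𝓝 0) := by
  have h1 : (fun t => g t * f t / t ^ 3) =O[𝓝[>] (0:ℝ)] (fun t => g t * t) := by
    have h := ((isBigO_refl g (𝓝[>] (0:ℝ))).mul hf).mul
      (isBigO_refl (fun t : ℝ => (t ^ 3)⁻¹) (𝓝[>] (0:ℝ)))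
    refine h.congr' (Eventually.of_forall fun t => by simp [div_eq_mul_inv]) ?_
    filter_upwards [self_mem_nhdsWithin] with t ht
    have : t ≠ 0 := ne_of_gt ht
    field_simp
  exact h1.trans_tendsto hg

lemma log_lim {a : ℝ} (ha : 0 < a) :
    Tendsto (fun t => Real.log (t * a) * t) (𝓝[>] (0:ℝ)) (𝓝 0) := by
  have h1 := tendsto_log_mul_rpow_nhdsGT_zero zero_lt_one
  have h2 : Tendsto (fun t : ℝ => Real.log a * t) (𝓝[>] (0:ℝ)) (𝓝 0) := by
    have : Continuous (fun t : ℝ => Real.log a * t) := by fun_prop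
    simpa using (this.tendsto 0).mono_left (nhdsWithin_le_nhds (s := Set.Ioi 0))
  have h3 := h1.add h2
  rw [add_zero] at h3
  refine h3.congr' ?_
  filter_upwards [self_mem_nhdsWithin] with t ht
  rw [Real.log_mul (ne_of_gt ht) ha.ne', Real.rpow_one]
  ring

/-- The reduced dilogarithm identity at degree ℓ = 3 of type A₁⁽¹⁾, formulated
asymptotically along the ray `(y₁, y₂) = (ta, tb)`: the discrepancy is `o(t³)` as `t → 0⁺`. -/
theorem A1affine_reduced_DI_deg3 (a b : ℝ) (ha : 0 < a) (hb : 0 < b) :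
    Filter.Tendsto
      (fun t : ℝ =>
        (Ltilde (t * b + 2 * (t * a) * (t * b) + (t * a) ^ 2 * (t * b)) + Ltilde (t * a)
          - Ltilde (t * a - 2 * (t * a) * (t * b) - 4 * (t * a) ^ 2 * (t * b)
              + 3 * (t * a) * (t * b) ^ 2)
          - Ltilde ((t * a) ^ 2 * (t * b))
          - 2 * Ltilde ((t * a) * (t * b) - 2 * (t * a) * (t * b) ^ 2)
          - Ltilde ((t * a) * (t * b) ^ 2)
          - Ltilde (t * b)) / t ^ 3)
      (nhdsWithin 0 (Set.Ioi 0)) (nhds 0) := by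
  have e1 : ∀ t : ℝ, t * b + 2 * (t * a) * (t * b) + (t * a) ^ 2 * (t * b)
      = b * t + (2 * a * b) * t ^ 2 + (a ^ 2 * b) * t ^ 3 := fun t => by ring
  have e2 : ∀ t : ℝ, t * a = a * t + 0 * t ^ 2 + 0 * t ^ 3 := fun t => by ring
  have e3 : ∀ t : ℝ, t * a - 2 * (t * a) * (t * b) - 4 * (t * a) ^ 2 * (t * b)
      + 3 * (t * a) * (t * b) ^ 2
      = a * t + (-2 * a * b) * t ^ 2 + (-4 * a ^ 2 * b + 3 * a * b ^ 2) * t ^ 3 :=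
    fun t => by ring
  have e4 : ∀ t : ℝ, (t * a) ^ 2 * (t * b) = 0 * t + 0 * t ^ 2 + (a ^ 2 * b) * t ^ 3 :=
    fun t => by ring
  have e5 : ∀ t : ℝ, (t * a) * (t * b) - 2 * (t * a) * (t * b) ^ 2
      = 0 * t + (a * b) * t ^ 2 + (-2 * a * b ^ 2) * t ^ 3 := fun t => by ring
  have e6 : ∀ t : ℝ, (t * a) * (t * b) ^ 2 = 0 * t + 0 * t ^ 2 + (a * b ^ 2) * t ^ 3 :=
    fun t => by ring
  have e7 : ∀ t : ℝ, t * b = b * t + 0 * t ^ 2 + 0 * t ^ 3 := fun t => by ring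
  have e8 : ∀ t : ℝ, -2 * (t * b) - 4 * (t * a) * (t * b) + 3 * (t * b) ^ 2
      = (-2 * b) * t + (-4 * a * b + 3 * b ^ 2) * t ^ 2 + 0 * t ^ 3 := fun t => by ring
  have e9 : ∀ t : ℝ, -2 * (t * b) = (-2 * b) * t + 0 * t ^ 2 + 0 * t ^ 3 := fun t => by ring
  have hpos : ∀ᶠ t in 𝓝[>] (0:ℝ), 0 < t := self_mem_nhdsWithin
  have hc : ∀ᶠ t in 𝓝[>] (0:ℝ), 0 < 1 + (-2 * (t * b) - 4 * (t * a) * (t * b) + 3 * (t * b) ^ 2) :=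
    ev_pos (by fun_prop) (by simp)
  have he : ∀ᶠ t in 𝓝[>] (0:ℝ), 0 < 1 + (-2 * (t * b)) :=
    ev_pos (by fun_prop) (by simp)
  have f3 : ∀ t : ℝ, t * a - 2 * (t * a) * (t * b) - 4 * (t * a) ^ 2 * (t * b)
      + 3 * (t * a) * (t * b) ^ 2
      = (t * a) * (1 + (-2 * (t * b) - 4 * (t * a) * (t * b) + 3 * (t * b) ^ 2)) :=
    fun t => by ring
  have f5 : ∀ t : ℝ, (t * a) * (t * b) - 2 * (t * a) * (t * b) ^ 2
      = (t * a) * (t * b) * (1 + (-2 * (t * b))) := fun t => by ring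
  have f1 : ∀ t : ℝ, t * b + 2 * (t * a) * (t * b) + (t * a) ^ 2 * (t * b)
      = (t * b) * (1 + t * a) ^ 2 := fun t => by ring
  have l1 := jet_log _ _ _ e1
  have l2 := jet_log _ _ _ e2
  have l3 := jet_log _ _ _ e3
  have l4 := jet_log _ _ _ e4
  have l5 := jet_log _ _ _ e5
  have l6 := jet_log _ _ _ e6
  have l7 := jet_log _ _ _ e7
  have l8 := jet_log _ _ _ e8
  have l9 := jet_log _ _ _ e9
  have i1 := jet_int _ _ _ e1 (hpos.mono fun t ht => by positivity)
  have i2 := jet_int _ _ _ e2 (hpos.mono fun t ht => by positivity)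
  have i3 := jet_int _ _ _ e3 ((hpos.and hc).mono fun t ht => by
    obtain ⟨h1, h2⟩ := ht
    rw [f3]; positivity)
  have i4 := jet_int _ _ _ e4 (hpos.mono fun t ht => by positivity)
  have i5 := jet_int _ _ _ e5 ((hpos.and he).mono fun t ht => by
    obtain ⟨h1, h2⟩ := ht
    rw [f5]; positivity)
  have i6 := jet_int _ _ _ e6 (hpos.mono fun t ht => by positivity)
  have i7 := jet_int _ _ _ e7 (hpos.mono fun t ht => by positivity)
  have P := ((((l1.add (l4.smul (-1))).add (l5.smul (-2))).add (l6.smul (-2))).add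
    (l7.smul (-1))).zero (by ring) (by ring) (by ring)
  have Q := ((((l2.add (l3.smul (-1))).add (l4.smul (-2))).add (l5.smul (-2))).add
    (l6.smul (-1))).zero (by ring) (by ring) (by ring)
  have R := (((((((((i1.add i2).add (i3.smul (-1))).add (i4.smul (-1))).add (i5.smul (-2))).add
    (i6.smul (-1))).add (i7.smul (-1))).add ((l2.mul l1).smul (-1))).add
    ((l8.mul l3).smul (1 / 2))).add (l9.mul l5)).zero (by ring) (by ring) (by ring)
  have LP := lim_of_bigO P _ (log_lim hb)
  have LQ := lim_of_bigO Q _ (log_lim ha)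
  have LR := lim_of_bigO R (fun _ => 1) (by
    simp only [one_mul]
    exact (tendsto_id (α := ℝ) (x := 𝓝 0)).mono_left (nhdsWithin_le_nhds (s := Set.Ioi 0)))
  have L := LR.add ((LP.add LQ).const_mul (-1 / 2))
  simp only [add_zero, mul_zero] at L
  refine L.congr' ?_
  filter_upwards [hpos, hc, he] with t ht hct het
  have hx : 0 < t * a := by positivity
  have hy : 0 < t * b := by positivity
  have g1 : Real.log (t * b + 2 * (t * a) * (t * b) + (t * a) ^ 2 * (t * b))
      = Real.log (t * b) + 2 * Real.log (1 + t * a) := by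
    rw [f1, Real.log_mul hy.ne' (by positivity), Real.log_pow]
    norm_num
  have g3 := congrArg Real.log (f3 t)
  rw [Real.log_mul hx.ne' hct.ne'] at g3
  have g5 := congrArg Real.log (f5 t)
  rw [Real.log_mul (by positivity) het.ne', Real.log_mul hx.ne' hy.ne'] at g5
  have g4 : Real.log ((t * a) ^ 2 * (t * b)) = 2 * Real.log (t * a) + Real.log (t * b) := by
    rw [Real.log_mul (by positivity) hy.ne', Real.log_pow]
    norm_num
  have g6 : Real.log ((t * a) * (t * b) ^ 2) = Real.log (t * a) + 2 * Real.log (t * b) := by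
    rw [Real.log_mul hx.ne' (by positivity), Real.log_pow]
    norm_num
  unfold Ltilde
  rw [g1, g3, g4, g5, g6]
  ring
end

section
/- Fix real numbers a > 0 and b > 0 and set y₁ = t·a, y₂ = t·b for t > 0. Define D(t) = 4·L̃(y₂ + y₁y₂) + L̃(y₁) − L̃(y₁ − 4y₁y₂ − 4y₁²y₂ + 10y₁y₂²) − 4·L̃(y₁y₂ − 4y₁y₂²) − 6·L̃(y₁y₂²) − 4·L̃(y₂), which is defined for all sufficiently small t > 0 (so that all arguments are positive). Then D(t)/t³ → 0 as t → 0⁺. -/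
open Filter Topology Asymptotics MeasureTheory

noncomputable def ddP (x : ℝ) : ℝ := x - x ^ 2 / 4 + x ^ 3 / 9
noncomputable def ddQ (x : ℝ) : ℝ := x - x ^ 2 / 2 + x ^ 3 / 3
noncomputable def ddR (x : ℝ) : ℝ := Ltilde x - (ddP x - 1 / 2 * Real.log x * ddQ x)
noncomputable def ddE (s : ℝ) : ℝ := Real.log (1 + s) - (s - s ^ 2 / 2)

lemma dd_log3 (x : ℝ) (h : |x| ≤ 1 / 2) : |Real.log (1 + x) - ddQ x| ≤ 2 * |x| ^ 4 := by
  have h1 := Real.abs_log_sub_add_sum_range_le (x := -x) (by rw [abs_neg]; linarith) 3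
  rw [abs_neg] at h1
  have h2 : |x| ^ 4 / (1 - |x|) ≤ 2 * |x| ^ 4 := by
    rw [div_le_iff₀ (by linarith)]
    nlinarith [pow_nonneg (abs_nonneg x) 4]
  have h3 : (∑ i ∈ Finset.range 3, (-x) ^ (i + 1) / ((i : ℝ) + 1)) + Real.log (1 - -x)
      = Real.log (1 + x) - ddQ x := by
    simp [Finset.sum_range_succ, ddQ]; ring
  rw [h3] at h1
  exact h1.trans h2

lemma dd_log2 (x : ℝ) (h : |x| ≤ 1 / 2) : |ddE x| ≤ 2 * |x| ^ 3 := by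
  have h1 := Real.abs_log_sub_add_sum_range_le (x := -x) (by rw [abs_neg]; linarith) 2
  rw [abs_neg] at h1
  have h2 : |x| ^ 3 / (1 - |x|) ≤ 2 * |x| ^ 3 := by
    rw [div_le_iff₀ (by linarith)]
    nlinarith [pow_nonneg (abs_nonneg x) 3]
  have h3 : (∑ i ∈ Finset.range 2, (-x) ^ (i + 1) / ((i : ℝ) + 1)) + Real.log (1 - -x)
      = ddE x := by
    simp [Finset.sum_range_succ, ddE]; ring
  rw [h3] at h1
  exact h1.trans h2

lemma dd_int (x : ℝ) (h0 : 0 < x) (h : x ≤ 1 / 2) :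
    |(∫ t in (0 : ℝ)..x, Real.log (1 + t) / t) - ddP x| ≤ 2 * x ^ 4 := by
  have hb : ∀ t ∈ Set.uIoc 0 x,
      ‖Real.log (1 + t) / t - (1 - t / 2 + t ^ 2 / 3)‖ ≤ 2 * x ^ 3 := by
    intro t ht
    rw [Set.uIoc_of_le h0.le] at ht
    obtain ⟨ht0, htx⟩ := ht
    have h1 := dd_log3 t (by rw [abs_of_pos ht0]; linarith)
    have h2 : Real.log (1 + t) / t - (1 - t / 2 + t ^ 2 / 3) = (Real.log (1 + t) - ddQ t) / t := by
      unfold ddQ; field_simp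
    rw [h2, Real.norm_eq_abs, abs_div, abs_of_pos ht0, div_le_iff₀ ht0]
    rw [abs_of_pos ht0] at h1
    have h3 : t ^ 3 ≤ x ^ 3 := by gcongr
    nlinarith
  have hi1 : IntervalIntegrable (fun t : ℝ => 1 - t / 2 + t ^ 2 / 3) volume 0 x :=
    Continuous.intervalIntegrable (by fun_prop) _ _
  have hi2 : IntervalIntegrable
      (fun t : ℝ => Real.log (1 + t) / t - (1 - t / 2 + t ^ 2 / 3)) volume 0 x := by
    rw [intervalIntegrable_iff]
    refine Measure.integrableOn_of_bounded (M := 2 * x ^ 3) ?_ ?_ ?_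
    · simp [Set.uIoc]
    · exact Measurable.aestronglyMeasurable (by fun_prop)
    · exact (ae_restrict_mem measurableSet_uIoc).mono hb
  have hi : IntervalIntegrable (fun t : ℝ => Real.log (1 + t) / t) volume 0 x := by
    have := hi2.add hi1
    refine this.congr ?_
    intro t _
    simp
  have hP : (∫ t in (0 : ℝ)..x, (1 - t / 2 + t ^ 2 / 3)) = ddP x := by
    rw [intervalIntegral.integral_eq_sub_of_hasDerivAt (f := ddP) _ hi1]
    · simp [ddP]
    · intro t _
      unfold ddP
      have := (((hasDerivAt_id t).sub (((hasDerivAt_id t).pow 2).div_const 4)).add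
        (((hasDerivAt_id t).pow 3).div_const 9))
      convert! this using 1
      simp; ring
  rw [← hP, ← intervalIntegral.integral_sub hi hi1]
  have := intervalIntegral.norm_integral_le_of_norm_le_const hb
  rw [Real.norm_eq_abs, sub_zero, abs_of_pos h0] at this
  linarith

lemma dd_tlog : Tendsto (fun t : ℝ => t * Real.log t) (𝓝[>] 0) (𝓝 0) := by
  have h := tendsto_log_mul_rpow_nhdsGT_zero zero_lt_one
  simpa [mul_comm] using h

lemma dd_R : ddR =o[𝓝[>] 0] (fun x : ℝ => x ^ 3) := by
  have hO : ddR =O[𝓝[>] 0] (fun x : ℝ => x ^ 3 * (|x| + |x * Real.log x|)) := by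
    refine IsBigO.of_bound 2 ?_
    filter_upwards [Ioo_mem_nhdsGT (show (0 : ℝ) < 1 / 2 by norm_num)] with x hx
    obtain ⟨h0, h1⟩ := hx
    have e1 := dd_int x h0 h1.le
    have e2 := dd_log3 x (by rw [abs_of_pos h0]; linarith)
    rw [abs_of_pos h0] at e2
    have e3 : ddR x = ((∫ t in (0 : ℝ)..x, Real.log (1 + t) / t) - ddP x)
        - 1 / 2 * Real.log x * (Real.log (1 + x) - ddQ x) := by
      unfold ddR Ltilde; ring
    have e4 : |1 / 2 * Real.log x * (Real.log (1 + x) - ddQ x)| ≤ |Real.log x| * (2 * x ^ 4) := by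
      rw [abs_mul, abs_mul]
      have : |(1 / 2 : ℝ)| * |Real.log x| ≤ |Real.log x| := by
        rw [abs_of_pos (by norm_num)]; linarith [abs_nonneg (Real.log x)]
      gcongr
    rw [Real.norm_eq_abs, Real.norm_eq_abs, abs_mul, abs_of_nonneg (a := |x| + _) (by positivity),
      abs_mul, abs_of_pos h0, abs_of_pos (pow_pos h0 3), e3]
    refine (abs_sub _ _).trans ?_
    nlinarith
  refine hO.trans_isLittleO ?_
  have hz : Tendsto (fun x : ℝ => |x| + |x * Real.log x|) (𝓝[>] 0) (𝓝 0) := by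
    have h1 : Tendsto (fun x : ℝ => |x|) (𝓝[>] 0) (𝓝 0) := by
      have : Tendsto (fun x : ℝ => |x|) (𝓝 0) (𝓝 |0|) := continuous_abs.tendsto 0
      rw [abs_zero] at this
      exact this.mono_left nhdsWithin_le_nhds
    simpa using h1.add dd_tlog.abs
  have := (isBigO_refl (fun x : ℝ => x ^ 3) (𝓝[>] 0)).mul_isLittleO
    ((isLittleO_one_iff ℝ).2 hz)
  simpa using this

lemma dd_cO (c : ℝ → ℝ) (hc : Continuous c) : c =O[𝓝[>] 0] (fun _ => (1 : ℝ)) :=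
  ((hc.tendsto 0).mono_left nhdsWithin_le_nhds).isBigO_one ℝ

lemma dd_tcO (c : ℝ → ℝ) (hc : Continuous c) :
    (fun t => t * c t) =O[𝓝[>] 0] (fun t : ℝ => t) := by
  simpa using (isBigO_refl (fun t : ℝ => t) (𝓝[>] 0)).mul (dd_cO c hc)

lemma dd_tc0 (c : ℝ → ℝ) (hc : Continuous c) :
    Tendsto (fun t => t * c t) (𝓝[>] 0) (𝓝 0) := by
  have : Continuous (fun t => t * c t) := by fun_prop
  have h := (this.tendsto 0).mono_left (nhdsWithin_le_nhds (s := Set.Ioi 0))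
  simpa using h

lemma dd_Rc (x c : ℝ → ℝ) (hx : ∀ t, x t = t * c t) (hc : Continuous c) (hc0 : 0 < c 0) :
    (fun t => ddR (x t)) =o[𝓝[>] 0] (fun t : ℝ => t ^ 3) := by
  obtain rfl : x = fun t => t * c t := funext hx
  have hp : ∀ᶠ t in 𝓝[>] (0 : ℝ), 0 < t * c t := by
    have : ∀ᶠ t in 𝓝[>] (0 : ℝ), 0 < c t :=
      ((hc.tendsto 0).eventually (lt_mem_nhds hc0)).filter_mono nhdsWithin_le_nhds
    filter_upwards [this, self_mem_nhdsWithin] with t h1 h2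
    exact mul_pos h2 h1
  have ht : Tendsto (fun t => t * c t) (𝓝[>] 0) (𝓝[>] 0) :=
    tendsto_nhdsWithin_iff.2 ⟨dd_tc0 c hc, hp⟩
  exact (dd_R.comp_tendsto ht).trans_isBigO ((dd_tcO c hc).pow 3)

lemma dd_Rc0 (x c : ℝ → ℝ) (hx : ∀ t, x t = t * c t) (hc : Continuous c)
    (hc0 : ∀ t, 0 < t → 0 < c t) :
    (fun t => ddR (x t)) =o[𝓝[>] 0] (fun t : ℝ => t ^ 3) := by
  obtain rfl : x = fun t => t * c t := funext hx
  have hp : ∀ᶠ t in 𝓝[>] (0 : ℝ), 0 < t * c t := by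
    filter_upwards [self_mem_nhdsWithin] with t h2
    exact mul_pos h2 (hc0 t h2)
  have ht : Tendsto (fun t => t * c t) (𝓝[>] 0) (𝓝[>] 0) :=
    tendsto_nhdsWithin_iff.2 ⟨dd_tc0 c hc, hp⟩
  exact (dd_R.comp_tendsto ht).trans_isBigO ((dd_tcO c hc).pow 3)

lemma dd_Ec (y d x c : ℝ → ℝ) (hy : ∀ t, y t = t * d t) (hd : Continuous d)
    (hx : ∀ t, x t = t * c t) (hc : Continuous c) :
    (fun t => y t * ddE (x t)) =o[𝓝[>] 0] (fun t : ℝ => t ^ 3) := by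
  obtain rfl : x = fun t => t * c t := funext hx
  obtain rfl : y = fun t => t * d t := funext hy
  have h1 : ddE =O[𝓝 0] (fun s : ℝ => s ^ 3) := by
    refine IsBigO.of_bound 2 ?_
    filter_upwards [Metric.closedBall_mem_nhds (0 : ℝ) (show (0 : ℝ) < 1 / 2 by norm_num)] with s hs
    have := dd_log2 s (by simpa using hs)
    simpa using this
  have h2 := (h1.comp_tendsto (dd_tc0 c hc)).trans ((dd_tcO c hc).pow 3)
  have h3 := (((dd_tc0 d hd)).isBigO_one ℝ).mul h2
  have h4 : (fun t => t * d t) =o[𝓝[>] 0] (fun _ => (1 : ℝ)) :=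
    (isLittleO_one_iff ℝ).2 (dd_tc0 d hd)
  simpa using h4.mul_isBigO h2

lemma dd_t4 (f : ℝ → ℝ) (hf : Tendsto (fun t => t * f t) (𝓝[>] 0) (𝓝 0)) (p : ℝ → ℝ)
    (hp : Continuous p) :
    (fun t => t ^ 4 * (f t * p t)) =o[𝓝[>] 0] (fun t : ℝ => t ^ 3) := by
  have h := ((isBigO_refl (fun x : ℝ => x ^ 3) (𝓝[>] 0)).mul_isLittleO
    ((isLittleO_one_iff ℝ).2 hf)).mul_isBigO (dd_cO p hp)
  refine (h.congr_left ?_).congr_right ?_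
  · intro t; ring
  · intro t; ring

lemma dd_tlogc (a : ℝ) (ha : 0 < a) :
    Tendsto (fun t : ℝ => t * Real.log (t * a)) (𝓝[>] 0) (𝓝 0) := by
  have h1 := dd_tlog.add (dd_tc0 (fun _ => Real.log a) continuous_const)
  rw [add_zero] at h1
  refine h1.congr' ?_
  filter_upwards [self_mem_nhdsWithin] with t ht
  rw [Real.log_mul (ne_of_gt ht) ha.ne']; ring

noncomputable def ddp1 (a b t : ℝ) : ℝ := (38/3)*a^1*b^3*t^0
    + (-31)*a^1*b^4*t^1
    + (300)*a^1*b^5*t^2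
    + (-250)*a^1*b^6*t^3
    + (10)*a^2*b^2*t^0
    + (101/3)*a^2*b^3*t^1
    + (-227)*a^2*b^4*t^2
    + (-20)*a^2*b^5*t^3
    + (1328)*a^2*b^6*t^4
    + (-2000)*a^2*b^7*t^5
    + (1250)*a^2*b^8*t^6
    + (2/3)*a^3*b^1*t^0
    + (-1/3)*a^3*b^2*t^1
    + (373/9)*a^3*b^3*t^2
    + (193/3)*a^3*b^4*t^3
    + (-2468/3)*a^3*b^5*t^4
    + (636)*a^3*b^6*t^5
    + (13744/3)*a^3*b^7*t^6
    + (-41476/3)*a^3*b^8*t^7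
    + (50000/3)*a^3*b^9*t^8
    + (-25000/3)*a^3*b^10*t^9
    + (2/3)*a^4*b^1*t^1
    + (1/6)*a^4*b^2*t^2
    + (-17)*a^4*b^3*t^3
    + (240)*a^4*b^4*t^4
    + (-60)*a^4*b^5*t^5
    + (-14000/3)*a^4*b^6*t^6
    + (52000/3)*a^4*b^7*t^7
    + (-80000/3)*a^4*b^8*t^8
    + (50000/3)*a^4*b^9*t^9
    + (4/3)*a^5*b^2*t^3
    + (-79/3)*a^5*b^3*t^4
    + (200/3)*a^5*b^4*t^5
    + (3520/3)*a^5*b^5*t^6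
    + (-7200)*a^5*b^6*t^7
    + (16000)*a^5*b^7*t^8
    + (-40000/3)*a^5*b^8*t^9
    + (-80/9)*a^6*b^3*t^5
    + (-160/3)*a^6*b^4*t^6
    + (3200/3)*a^6*b^5*t^7
    + (-12800/3)*a^6*b^6*t^8
    + (16000/3)*a^6*b^7*t^9
    + (-64/3)*a^7*b^4*t^7
    + (1280/3)*a^7*b^5*t^8
    + (-3200/3)*a^7*b^6*t^9
    + (256/3)*a^8*b^5*t^9

noncomputable def ddp2 (a b t : ℝ) : ℝ := (-10)*a^2*b^2*t^0
    + (28)*a^2*b^3*t^1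
    + (-85/2)*a^2*b^4*t^2
    + (5)*a^3*b^2*t^1
    + (-30)*a^3*b^3*t^2
    + (122)*a^3*b^4*t^3
    + (-168)*a^3*b^5*t^4
    + (125)*a^3*b^6*t^5
    + (-2)*a^4*b^1*t^1
    + (12)*a^4*b^2*t^2
    + (-72)*a^4*b^3*t^3
    + (160)*a^4*b^4*t^4
    + (-200)*a^4*b^5*t^5
    + (8)*a^5*b^2*t^3
    + (-32)*a^5*b^3*t^4
    + (80)*a^5*b^4*t^5
    + (-32/3)*a^6*b^3*t^5

noncomputable def ddp3 (a b t : ℝ) : ℝ := (-2)*a^1*b^3*t^0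
    + (6)*a^2*b^3*t^1
    + (-19)*a^2*b^4*t^2
    + (-8)*a^3*b^4*t^3
    + (32)*a^3*b^5*t^4
    + (-122/3)*a^3*b^6*t^5

set_option maxHeartbeats 4000000 in
lemma dd_poly (a b t lu lv : ℝ) (A B C S : ℝ) (hS : S = (t * (-4 * b - 4 * a * b * t + 10 * b ^ 2 * t))) :
    4 * (ddP (t * b + (t * a) * (t * b)) - 1 / 2 * (lv + (A + (t * a - (t * a) ^ 2 / 2))) * ddQ (t * b + (t * a) * (t * b)))
    + (ddP (t * a) - 1 / 2 * lu * ddQ (t * a))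
    - (ddP (t * a * (1 + S)) - 1 / 2 * (lu + (B + (S - S ^ 2 / 2))) * ddQ (t * a * (1 + S)))
    - 4 * (ddP ((t * a) * (t * b) - 4 * (t * a) * (t * b) ^ 2) - 1 / 2 * (lu + lv + (C + (t * (-4 * b) - (t * (-4 * b)) ^ 2 / 2))) * ddQ ((t * a) * (t * b) - 4 * (t * a) * (t * b) ^ 2))
    - 6 * (ddP ((t * a) * (t * b) ^ 2) - 1 / 2 * (lu + 2 * lv) * ddQ ((t * a) * (t * b) ^ 2))
    - 4 * (ddP (t * b) - 1 / 2 * lv * ddQ (t * b))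
    = - 2 * (ddQ (t * b + (t * a) * (t * b)) * A) + 1 / 2 * (ddQ (t * a * (1 + S)) * B)
      + 2 * (ddQ ((t * a) * (t * b) - 4 * (t * a) * (t * b) ^ 2) * C)
      + t ^ 4 * (1 * ddp1 a b t) + t ^ 4 * (lu * ddp2 a b t) + t ^ 4 * (lv * ddp3 a b t) := by
  subst hS
  unfold ddP ddQ ddp1 ddp2 ddp3
  ring

/-- The reduced dilogarithm identity at degree ℓ = 3 of type A₂⁽²⁾, formulated
asymptotically along the ray `(y₁, y₂) = (ta, tb)`: the discrepancy is `o(t³)` as `t → 0⁺`. -/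
theorem A2affine_reduced_DI_deg3 (a b : ℝ) (ha : 0 < a) (hb : 0 < b) :
    Filter.Tendsto
      (fun t : ℝ =>
        (4 * Ltilde (t * b + (t * a) * (t * b)) + Ltilde (t * a)
          - Ltilde (t * a - 4 * (t * a) * (t * b) - 4 * (t * a) ^ 2 * (t * b)
              + 10 * (t * a) * (t * b) ^ 2)
          - 4 * Ltilde ((t * a) * (t * b) - 4 * (t * a) * (t * b) ^ 2)
          - 6 * Ltilde ((t * a) * (t * b) ^ 2)
          - 4 * Ltilde (t * b)) / t ^ 3)
      (nhdsWithin 0 (Set.Ioi 0)) (nhds 0) := by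
  have hQ : ∀ x : ℝ, ddQ x = x * (1 - x / 2 + x ^ 2 / 3) := by intro x; unfold ddQ; ring
  set S : ℝ → ℝ := fun t => t * (-4 * b - 4 * a * b * t + 10 * b ^ 2 * t) with hS
  have hSc : Continuous S := by fun_prop
  -- remainders of the dilogarithm
  have r1 := dd_Rc (fun t => t * b + (t * a) * (t * b)) (fun t => b + t * a * b)
    (fun t => by ring) (by fun_prop) (by simpa using hb)
  have r2 := dd_Rc (fun t => t * a) (fun _ => a) (fun t => by ring) (by fun_prop) ha
  have r3 := dd_Rc (fun t => t * a * (1 + S t)) (fun t => a * (1 + S t))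
    (fun t => by ring) (by fun_prop) (by simpa [hS] using ha)
  have r6 := dd_Rc (fun t => t * b) (fun _ => b) (fun t => by ring) (by fun_prop) hb
  have r5 := dd_Rc0 (fun t => (t * a) * (t * b) ^ 2) (fun t => a * (t * b) ^ 2)
    (fun t => by ring) (by fun_prop) (fun t ht => by positivity)
  have hsmall : ∀ᶠ t in 𝓝[>] (0 : ℝ), 0 < 1 + t * (-4 * b) := by
    have : Tendsto (fun t : ℝ => 1 + t * (-4 * b)) (𝓝[>] 0) (𝓝 (1 + 0)) :=
      (dd_tc0 (fun _ => -4 * b) continuous_const).const_add 1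
    exact this.eventually (lt_mem_nhds (by norm_num))
  have hsmall2 : ∀ᶠ t in 𝓝[>] (0 : ℝ), 0 < 1 + S t := by
    have : Tendsto (fun t : ℝ => 1 + S t) (𝓝[>] 0) (𝓝 (1 + 0)) :=
      (dd_tc0 (fun t => -4 * b - 4 * a * b * t + 10 * b ^ 2 * t) (by fun_prop)).const_add 1
    exact this.eventually (lt_mem_nhds (by norm_num))
  have r4 : (fun t => ddR ((t * a) * (t * b) - 4 * (t * a) * (t * b) ^ 2))
      =o[𝓝[>] 0] (fun t : ℝ => t ^ 3) := by
    have hc : Continuous (fun t : ℝ => a * (t * b) - 4 * a * (t * b) ^ 2) := by fun_prop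
    have ht : Tendsto (fun t => t * (a * (t * b) - 4 * a * (t * b) ^ 2)) (𝓝[>] 0) (𝓝[>] 0) := by
      refine tendsto_nhdsWithin_iff.2 ⟨dd_tc0 _ hc, ?_⟩
      filter_upwards [hsmall, self_mem_nhdsWithin] with t h1 h2
      have h2' : 0 < t := h2
      have : t * (a * (t * b) - 4 * a * (t * b) ^ 2) = t * a * (t * b) * (1 + t * (-4 * b)) := by
        ring
      rw [this]
      exact Set.mem_Ioi.2 (by positivity)
    refine ((dd_R.comp_tendsto ht).trans_isBigO ((dd_tcO _ hc).pow 3)).congr_left ?_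
    intro t
    simp only [Function.comp]
    congr 1; ring
  -- remainders of the logarithms
  have e1 := dd_Ec (fun t => ddQ (t * b + (t * a) * (t * b)))
    (fun t => (b + t * a * b) * (1 - (t * b + (t * a) * (t * b)) / 2
      + (t * b + (t * a) * (t * b)) ^ 2 / 3)) (fun t => t * a) (fun _ => a)
    (fun t => by rw [hQ]; ring) (by fun_prop) (fun t => by ring) (by fun_prop)
  have e2 := dd_Ec (fun t => ddQ (t * a * (1 + S t)))
    (fun t => (a * (1 + S t)) * (1 - (t * a * (1 + S t)) / 2
      + (t * a * (1 + S t)) ^ 2 / 3)) S (fun t => -4 * b - 4 * a * b * t + 10 * b ^ 2 * t)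
    (fun t => by rw [hQ]; ring) (by fun_prop) (fun t => rfl) (by fun_prop)
  have e3 := dd_Ec (fun t => ddQ ((t * a) * (t * b) - 4 * (t * a) * (t * b) ^ 2))
    (fun t => (a * (t * b) - 4 * a * (t * b) ^ 2)
      * (1 - ((t * a) * (t * b) - 4 * (t * a) * (t * b) ^ 2) / 2
      + ((t * a) * (t * b) - 4 * (t * a) * (t * b) ^ 2) ^ 2 / 3))
    (fun t => t * (-4 * b)) (fun _ => -4 * b)
    (fun t => by rw [hQ]; ring) (by fun_prop) (fun t => rfl) (by fun_prop)
  have q1 := dd_t4 (fun _ => 1) (dd_tc0 _ continuous_const) (ddp1 a b)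
    (by unfold ddp1; fun_prop)
  have q2 := dd_t4 (fun t => Real.log (t * a)) (dd_tlogc a ha) (ddp2 a b)
    (by unfold ddp2; fun_prop)
  have q3 := dd_t4 (fun t => Real.log (t * b)) (dd_tlogc b hb) (ddp3 a b)
    (by unfold ddp3; fun_prop)
  have total := (((((((r1.const_mul_left 4).add r2).sub r3).sub (r4.const_mul_left 4)).sub
    (r5.const_mul_left 6)).sub (r6.const_mul_left 4)).add
    ((((((e1.const_mul_left (-2)).add (e2.const_mul_left (1 / 2))).add
      (e3.const_mul_left 2)).add q1).add q2).add q3))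
  refine total.tendsto_div_nhds_zero.congr' ?_
  filter_upwards [hsmall, hsmall2, self_mem_nhdsWithin] with t h1 h2 h3
  have ht : 0 < t := h3
  congr 1
  have hu : 0 < t * a := mul_pos ht ha
  have hv : 0 < t * b := mul_pos ht hb
  have l1 : Real.log (t * b + (t * a) * (t * b))
      = Real.log (t * b) + (ddE (t * a) + (t * a - (t * a) ^ 2 / 2)) := by
    have : t * b + (t * a) * (t * b) = (t * b) * (1 + t * a) := by ring
    rw [this, Real.log_mul hv.ne' (by positivity)]
    unfold ddE; ring
  have l2 : Real.log (t * a * (1 + S t))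
      = Real.log (t * a) + (ddE (S t) + (S t - (S t) ^ 2 / 2)) := by
    rw [Real.log_mul hu.ne' h2.ne']
    unfold ddE; ring
  have l3 : Real.log ((t * a) * (t * b) - 4 * (t * a) * (t * b) ^ 2)
      = Real.log (t * a) + Real.log (t * b)
        + (ddE (t * (-4 * b)) + (t * (-4 * b) - (t * (-4 * b)) ^ 2 / 2)) := by
    have : (t * a) * (t * b) - 4 * (t * a) * (t * b) ^ 2
      = (t * a) * (t * b) * (1 + t * (-4 * b)) := by ring
    rw [this, Real.log_mul (by positivity) h1.ne', Real.log_mul hu.ne' hv.ne']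
    unfold ddE; ring
  have l4 : Real.log ((t * a) * (t * b) ^ 2) = Real.log (t * a) + 2 * Real.log (t * b) := by
    rw [Real.log_mul hu.ne' (by positivity), Real.log_pow]; norm_num
  have hw : t * a - 4 * (t * a) * (t * b) - 4 * (t * a) ^ 2 * (t * b)
              + 10 * (t * a) * (t * b) ^ 2 = t * a * (1 + S t) := by
    simp only [hS]; ring
  have hL : ∀ x, Ltilde x = ddR x + (ddP x - 1 / 2 * Real.log x * ddQ x) := by
    intro x; unfold ddR; ring
  have key := dd_poly a b t (Real.log (t * a)) (Real.log (t * b)) (ddE (t * a)) (ddE (S t))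
    (ddE (t * (-4 * b))) (S t) rfl
  rw [← l1, ← l2, ← l3, ← l4] at key
  rw [hw]
  simp only [hL]
  linear_combination -key
end
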